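/- arXiv:1911.04223 — 2 statements merged into one kernel-verified Lean document; each statement's English description precedes it below -/
import Mathlib

section
/- The ODE F̃'(y) = β N(y,F̃(y))/D(y,F̃(y)) with terminal condition F̃(ȳ) = x̃ (where x̃ is the unique zero of H) admits a unique solution F̃ on all of [0,ȳ], and this solution satisfies F̃'(y) ≥ β for every y ∈ [0,ȳ]. -/
open Set

/-- Parabolic cylinder function `D_α(x)` for `α < 0` (integral representation). -/
noncomputable def Dcyl (α x : ℝ) : ℝ :=
  Real.exp (-x ^ 2 / 4) / Real.Gamma (-α) *
    ∫ t in Ioi (0 : ℝ), t ^ (-α - 1) * Real.exp (-t ^ 2 / 2 - x * t)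

/-- Increasing fundamental solution of `(σ²/2)u'' + κ(μ−x)u' − ρu = 0`. -/
noncomputable def psi (κ μ σ ρ : ℝ) (x : ℝ) : ℝ :=
  Real.exp (κ * (x - μ) ^ 2 / (2 * σ ^ 2)) *
    Dcyl (-(ρ / κ)) (-((x - μ) / σ) * Real.sqrt (2 * κ))

/-- Decreasing fundamental solution of `(σ²/2)u'' + κ(μ−x)u' − ρu = 0`. -/
noncomputable def phi (κ μ σ ρ : ℝ) (x : ℝ) : ℝ :=
  Real.exp (κ * (x - μ) ^ 2 / (2 * σ ^ 2)) *
    Dcyl (-(ρ / κ)) (((x - μ) / σ) * Real.sqrt (2 * κ))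

/-- `R̃(z,y) = (μκ + ρz − β(ρ+2κ)y)/(ρ(ρ+κ))`. -/
noncomputable def Rt (κ μ ρ β : ℝ) (z y : ℝ) : ℝ :=
  (μ * κ + ρ * z - β * (ρ + 2 * κ) * y) / (ρ * (ρ + κ))

/-- `Q_k(z) = ψ^{(k)}(z)ψ^{(k+2)}(z) − (ψ^{(k+1)}(z))²`. -/
noncomputable def Q (κ μ σ ρ : ℝ) (k : ℕ) (z : ℝ) : ℝ :=
  iteratedDeriv k (psi κ μ σ ρ) z * iteratedDeriv (k + 2) (psi κ μ σ ρ) z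
    - (iteratedDeriv (k + 1) (psi κ μ σ ρ) z) ^ 2

/-- `D(y,z) = ψ(z)[(ρ+κ)(c − R̃(z,y))Q₁(z) + Q₀'(z)]`. -/
noncomputable def Dfun (κ μ σ ρ β c : ℝ) (y z : ℝ) : ℝ :=
  psi κ μ σ ρ z *
    ((ρ + κ) * (c - Rt κ μ ρ β z y) * Q κ μ σ ρ 1 z + deriv (Q κ μ σ ρ 0) z)

/-- `N(y,z) = Q₀(z)[((ρ+2κ)/ρ)ψ'(z) + (ρ+κ)(c − R̃(z,y))ψ''(z) + ψ'(z)]`. -/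
noncomputable def Nfun (κ μ σ ρ β c : ℝ) (y z : ℝ) : ℝ :=
  Q κ μ σ ρ 0 z *
    ((ρ + 2 * κ) / ρ * deriv (psi κ μ σ ρ) z +
      ((ρ + κ) * (c - Rt κ μ ρ β z y) * iteratedDeriv 2 (psi κ μ σ ρ) z
        + deriv (psi κ μ σ ρ) z))

/-- `H(x) = ψ'(x)(c − R̃(x, ybar)) + (ρ+κ)⁻¹ψ(x)`. -/
noncomputable def Hfun (κ μ σ ρ β c ybar : ℝ) (x : ℝ) : ℝ :=
  deriv (psi κ μ σ ρ) x * (c - Rt κ μ ρ β x ybar) + (ρ + κ)⁻¹ * psi κ μ σ ρ x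

open Filter Topology in
/-- Backward invariance: if each `u i` is strictly increasing at its zeros inside the region where
all `u j` are nonpositive, then this region is invariant going backward in time. -/
lemma nonpos_of_backward_barrier {ι : Type*} [Finite ι] {u u' : ι → ℝ → ℝ} {a b : ℝ}
    (hu : ∀ i, ∀ y ∈ Icc a b, HasDerivAt (u i) (u' i y) y)
    (hend : ∀ i, u i b ≤ 0)
    (hbar : ∀ y ∈ Icc a b, (∀ j, u j y ≤ 0) → ∀ i, u i y = 0 → 0 < u' i y) :
    ∀ y ∈ Icc a b, ∀ i, u i y ≤ 0 := by
  have hclosed : IsClosed ({y | ∀ i, u i y ≤ 0} ∩ Icc a b) := by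
    have : {y | ∀ i, u i y ≤ 0} ∩ Icc a b = Icc a b ∩ ⋂ i, (Icc a b ∩ u i ⁻¹' Iic 0) := by
      ext y
      simp only [mem_inter_iff, mem_ofPred_eq, mem_iInter, mem_preimage, mem_Iic]
      exact ⟨fun h => ⟨h.2, fun i => ⟨h.2, h.1 i⟩⟩, fun h => ⟨fun i => (h.2 i).2, h.1⟩⟩
    rw [this]
    refine isClosed_Icc.inter (isClosed_iInter fun i => ?_)
    exact ContinuousOn.preimage_isClosed_of_isClosed
      (fun y hy => (hu i y hy).continuousAt.continuousWithinAt) isClosed_Icc isClosed_Iic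
  refine hclosed.Icc_subset_of_forall_exists_lt hend ?_
  rintro x ⟨hx, hxab⟩ y hy
  have hxm : x ∈ Icc a b := Ioc_subset_Icc_self hxab
  have key : ∀ i, ∀ᶠ t in 𝓝[<] x, u i t ≤ 0 := by
    intro i
    rcases (hx i).lt_or_eq with h | h
    · exact nhdsWithin_le_nhds <| ((hu i x hxm).continuousAt.eventually_lt_const h).mono
        fun _ ht => ht.le
    · have hpos := hbar x hxm hx i h
      have := (hasDerivAt_iff_tendsto_slope_left_right.mp (hu i x hxm)).1
      filter_upwards [this.eventually (eventually_gt_nhds hpos), self_mem_nhdsWithin] with t ht htx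
      exact (neg_of_slope_pos htx ht h).le
  have h1 : ∀ᶠ t in 𝓝[<] x, t ∈ Ico y x := Ico_mem_nhdsLT hy
  obtain ⟨t, ht⟩ := ((eventually_all.2 key).and h1).exists
  exact ⟨t, ht.1, ht.2⟩

open NNReal in
/-- A bounded, globally Lipschitz vector field has solutions on every bounded time interval. -/
lemma exists_hasDerivAt_of_bounded_lipschitz {w : ℝ → ℝ → ℝ} {K C : ℝ≥0}
    (hw : ∀ t, LipschitzWith K (w t)) (hc : ∀ x, Continuous fun t => w t x)
    (hC : ∀ t x, ‖w t x‖ ≤ C) {a b t₀ : ℝ} (ht₀ : t₀ ∈ Icc a b) (x₀ : ℝ) :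
    ∃ F : ℝ → ℝ, F t₀ = x₀ ∧ ∀ t ∈ Ioo a b, HasDerivAt F (w t (F t)) t := by
  have hPL : IsPicardLindelof w (tmin := a) (tmax := b) ⟨t₀, ht₀⟩ x₀
      (C * Real.toNNReal (b - a)) 0 C K := by
    refine ⟨fun t _ => (hw t).lipschitzOnWith, fun x _ => (hc x).continuousOn,
      fun t _ x _ => hC t x, ?_⟩
    have h1 : a ≤ b := ht₀.1.trans ht₀.2
    have h2 : max (b - t₀) (t₀ - a) ≤ b - a :=
      max_le (by linarith [ht₀.1]) (by linarith [ht₀.2])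
    simpa [Real.coe_toNNReal _ (sub_nonneg.2 h1)] using
      mul_le_mul_of_nonneg_left h2 C.coe_nonneg
  obtain ⟨F, hF, hF'⟩ := hPL.exists_eq_forall_mem_Icc_hasDerivWithinAt₀
  exact ⟨F, hF, fun t ht => (hF' t (Ioo_subset_Icc_self ht)).hasDerivAt (Icc_mem_nhds ht.1 ht.2)⟩

/-- A field `γ z + δ z / (h z + m y)` agrees, for `z` in a compact interval and away from the
zeros of the denominator, with a bounded globally Lipschitz field. -/
lemma exists_bounded_lipschitz_extension {γ δ h : ℝ → ℝ} (hγ : ContDiff ℝ 1 γ)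
    (hδ : ContDiff ℝ 1 δ) (hh : ContDiff ℝ 1 h) (m : ℝ) {ε : ℝ} (hε : 0 < ε) {lo hi : ℝ}
    (hlohi : lo ≤ hi) :
    ∃ (w : ℝ → ℝ → ℝ) (K C : NNReal), (∀ t, LipschitzWith K (w t)) ∧
      (∀ x, Continuous fun t => w t x) ∧ (∀ t x, ‖w t x‖ ≤ C) ∧
      ∀ t, ∀ z ∈ Icc lo hi, ε ≤ h z + m * t → w t z = γ z + δ z / (h z + m * t) := by
  obtain ⟨Kγ, hKγ⟩ := (hγ.contDiffOn (s := Icc lo hi)).exists_lipschitzOnWith one_ne_zero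
    (convex_Icc _ _) isCompact_Icc
  obtain ⟨Kδ, hKδ⟩ := (hδ.contDiffOn (s := Icc lo hi)).exists_lipschitzOnWith one_ne_zero
    (convex_Icc _ _) isCompact_Icc
  obtain ⟨Kh, hKh⟩ := (hh.contDiffOn (s := Icc lo hi)).exists_lipschitzOnWith one_ne_zero
    (convex_Icc _ _) isCompact_Icc
  obtain ⟨Cγ, hCγ⟩ := isCompact_Icc.exists_bound_of_continuousOn
    (hγ.continuous.continuousOn (s := Icc lo hi))
  obtain ⟨Cδ, hCδ⟩ := isCompact_Icc.exists_bound_of_continuousOn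
    (hδ.continuous.continuousOn (s := Icc lo hi))
  have hCγ0 : 0 ≤ Cγ := (norm_nonneg _).trans (hCγ lo ⟨le_rfl, hlohi⟩)
  have hCδ0 : 0 ≤ Cδ := (norm_nonneg _).trans (hCδ lo ⟨le_rfl, hlohi⟩)
  set P : ℝ → ℝ := fun z => projIcc lo hi hlohi z with hP
  have hPm : ∀ z, P z ∈ Icc lo hi := fun z => (projIcc lo hi hlohi z).2
  have hPl : ∀ x y, |P x - P y| ≤ |x - y| := by
    intro x y
    have := (LipschitzWith.projIcc hlohi).dist_le_mul x y
    simpa [Subtype.dist_eq, Real.dist_eq] using this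
  have hlip : ∀ {f : ℝ → ℝ} {k : NNReal}, LipschitzOnWith k f (Icc lo hi) →
      ∀ x y, |f (P x) - f (P y)| ≤ k * |x - y| := by
    intro f k hf x y
    have := hf.dist_le_mul _ (hPm x) _ (hPm y)
    rw [Real.dist_eq, Real.dist_eq] at this
    exact this.trans (mul_le_mul_of_nonneg_left (hPl x y) k.coe_nonneg)
  have hmax : ∀ t z, ε ≤ max (h (P z) + m * t) ε := fun t z => le_max_right _ _
  have hmaxpos : ∀ t z, 0 < max (h (P z) + m * t) ε := fun t z => hε.trans_le (hmax t z)
  refine ⟨fun t z => γ (P z) + δ (P z) / max (h (P z) + m * t) ε,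
    Real.toNNReal (Kγ + Kδ / ε + Cδ * Kh / ε ^ 2), Real.toNNReal (Cγ + Cδ / ε), ?_, ?_, ?_, ?_⟩
  · intro t
    refine LipschitzWith.of_dist_le_mul fun x y => ?_
    rw [Real.dist_eq, Real.dist_eq]
    have e1 := hlip hKγ x y
    have e2 := hlip hKδ x y
    have e3 := hlip hKh x y
    have e4 := hCδ _ (hPm y)
    rw [Real.norm_eq_abs] at e4
    have hx := hmax t x
    have hy := hmax t y
    have hx0 := hmaxpos t x
    have hy0 := hmaxpos t y
    have e5 : |max (h (P y) + m * t) ε - max (h (P x) + m * t) ε| ≤ Kh * |x - y| := by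
      refine (abs_max_sub_max_le_abs _ _ _).trans ?_
      rw [abs_sub_comm]
      simpa using e3
    rw [Real.coe_toNNReal _ (by positivity)]
    beta_reduce
    generalize max (h (P x) + m * t) ε = X at *
    generalize max (h (P y) + m * t) ε = Y at *
    have e6 : γ (P x) + δ (P x) / X - (γ (P y) + δ (P y) / Y)
        = (γ (P x) - γ (P y)) + (δ (P x) - δ (P y)) / X + δ (P y) * (Y - X) / (X * Y) := by
      field_simp
      ring
    rw [e6]
    have e7 : |(δ (P x) - δ (P y)) / X| ≤ Kδ * |x - y| / ε := by
      rw [abs_div, abs_of_pos hx0]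
      gcongr
    have e8 : |δ (P y) * (Y - X) / (X * Y)| ≤ Cδ * (Kh * |x - y|) / ε ^ 2 := by
      rw [abs_div, abs_mul, abs_of_pos (mul_pos hx0 hy0), sq]
      gcongr
    refine (abs_add_le _ _).trans ((add_le_add ((abs_add_le _ _).trans (add_le_add e1 e7)) e8).trans
      (le_of_eq ?_))
    ring
  · intro x
    refine continuous_const.add (continuous_const.div ?_ fun t => (hmaxpos t x).ne')
    fun_prop
  · intro t x
    refine (norm_add_le _ _).trans ?_
    rw [Real.coe_toNNReal _ (by positivity)]
    refine add_le_add (hCγ _ (hPm x)) ?_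
    rw [norm_div, Real.norm_of_nonneg (hmaxpos t x).le]
    have := hCδ _ (hPm x)
    have := hmax t x
    gcongr
  · intro t z hz hle
    have : P z = z := by simp [hP, projIcc_of_mem hlohi hz]
    simp only [this, max_eq_left hle]

/-- Abstract free-boundary ODE: the field equals `γ z + δ z / (K₀ - z + m y + e z)` where the
denominator is positive, and the terminal point lies on `K₀ - z + m y + b z = 0`. -/
theorem exists_unique_backward_solution {γ δ e b : ℝ → ℝ} {v : ℝ → ℝ → ℝ} {K₀ m β T xt : ℝ}
    (hγ : ContDiff ℝ 1 γ) (hδ : ContDiff ℝ 1 δ) (he : ContDiff ℝ 1 e) (hb : ContDiff ℝ 1 b)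
    (hm : 0 < m) (hβ : 0 < β) (hT : 0 < T)
    (hγ0 : ∀ z, 0 < γ z) (hδ0 : ∀ z, 0 < δ z) (hb0 : ∀ z, 0 < b z) (hbe : ∀ z, b z < e z)
    (he' : ∀ z, deriv e z < 1)
    (hB : ∀ z, (γ z + δ z / (e z - b z)) * (1 - deriv b z) < m)
    (hβle : ∀ z, β ≤ γ z + δ z / (e z - b z))
    (hv : ∀ y z, 0 < K₀ - z + m * y + e z → v y z = γ z + δ z / (K₀ - z + m * y + e z))
    (hxt : K₀ - xt + m * T + b xt = 0) :
    ∃ F : ℝ → ℝ, F T = xt ∧ (∀ y ∈ Icc 0 T, HasDerivAt F (v y (F y)) y) ∧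
      (∀ y ∈ Icc 0 T, β ≤ v y (F y)) ∧
      ∀ G : ℝ → ℝ, G T = xt → (∀ y ∈ Icc 0 T, HasDerivAt G (v y (G y)) y) →
        EqOn F G (Icc 0 T) := by
  have hlo : K₀ ≤ xt := by have := hb0 xt; nlinarith
  have hk : Continuous fun z => δ z * (1 - deriv e z) :=
    hδ.continuous.mul (continuous_const.sub (he.continuous_deriv le_rfl))
  obtain ⟨z₀, _, hz₀⟩ := isCompact_Icc.exists_isMinOn (nonempty_Icc.2 hlo) hk.continuousOn
  set k₀ := δ z₀ * (1 - deriv e z₀) with hk₀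
  have hk₀pos : 0 < k₀ := mul_pos (hδ0 _) (by linarith [he' z₀])
  have hkle : ∀ z ∈ Icc K₀ xt, k₀ ≤ δ z * (1 - deriv e z) := fun z hz => hz₀ hz
  set ε := min (e xt - b xt) (k₀ / (2 * m)) with hεdef
  have hε : 0 < ε := lt_min (by linarith [hbe xt]) (by positivity)
  have hεm : ε * m < k₀ := by
    have : ε ≤ k₀ / (2 * m) := min_le_right _ _
    rw [le_div_iff₀ (by positivity)] at this
    nlinarith
  obtain ⟨w, K, C, hwK, hwc, hwC, hw⟩ := exists_bounded_lipschitz_extension hγ hδ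
    (h := fun z => K₀ - z + e z) ((contDiff_const.sub contDiff_id).add he) m hε hlo
  have hw' : ∀ y, ∀ z ∈ Icc K₀ xt, ε ≤ K₀ - z + m * y + e z →
      w y z = γ z + δ z / (K₀ - z + m * y + e z) := by
    intro y z hz hle
    have h1 : K₀ - z + e z + m * y = K₀ - z + m * y + e z := by ring
    have := hw y z hz (by rw [h1]; exact hle)
    rwa [h1] at this
  have hbmono : ∀ z y, 0 < K₀ - z + m * y + e z → K₀ - z + m * y + b z ≤ 0 →
      γ z + δ z / (e z - b z) ≤ γ z + δ z / (K₀ - z + m * y + e z) := by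
    intro z y h1 h2
    have := (hδ0 z).le
    gcongr
    linarith
  have invariant : ∀ (W : ℝ → ℝ → ℝ) (G : ℝ → ℝ),
      (∀ y, ∀ z ∈ Icc K₀ xt, ε ≤ K₀ - z + m * y + e z →
        W y z = γ z + δ z / (K₀ - z + m * y + e z)) →
      G T = xt → (∀ y ∈ Icc 0 T, HasDerivAt G (W y (G y)) y) →
      ∀ y ∈ Icc 0 T, G y ∈ Icc K₀ xt ∧ ε ≤ K₀ - G y + m * y + e (G y) ∧
        K₀ - G y + m * y + b (G y) ≤ 0 := by
    intro W G hW hG hG'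
    have region : ∀ y ∈ Icc 0 T, K₀ - G y + m * y + b (G y) ≤ 0 → K₀ ≤ G y := by
      intro y hy h
      have := hb0 (G y)
      have := mul_nonneg hm.le hy.1
      linarith
    have hu := nonpos_of_backward_barrier (a := 0) (b := T)
      (u := ![fun y => K₀ - G y + m * y + b (G y), fun y => ε - (K₀ - G y + m * y + e (G y)),
        fun y => G y - xt])
      (u' := ![fun y => -W y (G y) + m * 1 + deriv b (G y) * W y (G y),
        fun y => -(-W y (G y) + m * 1 + deriv e (G y) * W y (G y)), fun y => W y (G y)])
      (by
        intro i y hy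
        have hGy := hG' y hy
        have hbd := ((hb.differentiable one_ne_zero) (G y)).hasDerivAt.comp y hGy
        have hed := ((he.differentiable one_ne_zero) (G y)).hasDerivAt.comp y hGy
        have hA := (hGy.const_sub K₀).add ((hasDerivAt_id y).const_mul m)
        fin_cases i
        · exact hA.add hbd
        · exact (hA.add hed).const_sub ε
        · exact hGy.sub_const xt)
      (by
        have h1 : ε ≤ e xt - b xt := min_le_left _ _
        intro i
        fin_cases i <;> simp [hG] <;> linarith)
      (by
        intro y hy hall i hi
        have h0 : K₀ - G y + m * y + b (G y) ≤ 0 := hall 0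
        have h1 : ε - (K₀ - G y + m * y + e (G y)) ≤ 0 := hall 1
        have h2 : G y - xt ≤ 0 := hall 2
        have hmem : G y ∈ Icc K₀ xt := ⟨region y hy h0, by linarith⟩
        have hWy := hW y (G y) hmem (by linarith)
        have hge := hbmono (G y) y (by linarith) h0
        rw [← hWy] at hge
        fin_cases i
        · have hi' : K₀ - G y + m * y + b (G y) = 0 := hi
          have h3 : K₀ - G y + m * y + e (G y) = e (G y) - b (G y) := by linarith
          have h4 := hB (G y)
          rw [← h3, ← hWy] at h4
          show 0 < -W y (G y) + m * 1 + deriv b (G y) * W y (G y)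
          linarith
        · have hi' : ε - (K₀ - G y + m * y + e (G y)) = 0 := hi
          have h3 : K₀ - G y + m * y + e (G y) = ε := by linarith
          have h4 := hkle (G y) hmem
          have h5 := he' (G y)
          rw [h3] at hWy
          have h6 : δ (G y) / ε < W y (G y) := by rw [hWy]; linarith [hγ0 (G y)]
          have h7 : δ (G y) / ε * (1 - deriv e (G y)) < W y (G y) * (1 - deriv e (G y)) :=
            mul_lt_mul_of_pos_right h6 (by linarith)
          have h8 : m < δ (G y) / ε * (1 - deriv e (G y)) := by
            rw [div_mul_eq_mul_div, lt_div_iff₀ hε]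
            linarith
          show 0 < -(-W y (G y) + m * 1 + deriv e (G y) * W y (G y))
          linarith
        · show 0 < W y (G y)
          linarith [hβle (G y)])
    intro y hy
    have h0 : K₀ - G y + m * y + b (G y) ≤ 0 := hu y hy 0
    have h1 : ε - (K₀ - G y + m * y + e (G y)) ≤ 0 := hu y hy 1
    have h2 : G y - xt ≤ 0 := hu y hy 2
    exact ⟨⟨region y hy h0, by linarith⟩, by linarith, h0⟩
  obtain ⟨F, hFT, hF⟩ := exists_hasDerivAt_of_bounded_lipschitz hwK hwc hwC
    (a := -1) (b := T + 1) (t₀ := T) ⟨by linarith, by linarith⟩ xt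
  have hF' : ∀ y ∈ Icc 0 T, HasDerivAt F (w y (F y)) y := fun y hy =>
    hF y ⟨by linarith [hy.1], by linarith [hy.2]⟩
  have hFinv := invariant w F hw' hFT hF'
  have hvw : ∀ y z, z ∈ Icc K₀ xt → ε ≤ K₀ - z + m * y + e z → w y z = v y z := by
    intro y z hz hle
    rw [hw' y z hz hle, hv y z (by linarith)]
  refine ⟨F, hFT, fun y hy => ?_, fun y hy => ?_, fun G hGT hG => ?_⟩
  · obtain ⟨h1, h2, _⟩ := hFinv y hy
    rw [← hvw y _ h1 h2]
    exact hF' y hy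
  · obtain ⟨h1, h2, h3⟩ := hFinv y hy
    rw [hv y _ (by linarith)]
    exact (hβle _).trans (hbmono _ _ (by linarith) h3)
  · have hGinv := invariant v G (fun y z _ hle => hv y z (by linarith)) hGT hG
    have hG' : ∀ y ∈ Icc 0 T, HasDerivAt G (w y (G y)) y := by
      intro y hy
      obtain ⟨h1, h2, _⟩ := hGinv y hy
      rw [hvw y _ h1 h2]
      exact hG y hy
    exact ODE_solution_unique_of_mem_Icc_left (s := fun _ => univ)
      (fun t _ => (hwK t).lipschitzOnWith)
      (fun y hy => (hF' y hy).continuousAt.continuousWithinAt)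
      (fun y hy => (hF' y (Ioc_subset_Icc_self hy)).hasDerivWithinAt) (fun _ _ => mem_univ _)
      (fun y hy => (hG' y hy).continuousAt.continuousWithinAt)
      (fun y hy => (hG' y (Ioc_subset_Icc_self hy)).hasDerivWithinAt) (fun _ _ => mem_univ _)
      (by rw [hFT, hGT])

/-- The moment `∫₀^∞ t ^ b exp(-t²/2 + s t) dt` of a tilted half-Gaussian weight. -/
noncomputable def tiltedMoment (b s : ℝ) : ℝ :=
  ∫ t in Ioi (0 : ℝ), t ^ b * Real.exp (-t ^ 2 / 2 + s * t)

open MeasureTheory in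
lemma integrableOn_tiltedMoment {b : ℝ} (hb : -1 < b) (s : ℝ) :
    IntegrableOn (fun t : ℝ => t ^ b * Real.exp (-t ^ 2 / 2 + s * t)) (Ioi 0) := by
  have h := (integrableOn_rpow_mul_exp_neg_mul_sq (b := 1 / 4) (by norm_num) hb).const_mul
    (Real.exp (s ^ 2))
  refine Integrable.mono' h ?_ ?_
  · refine ContinuousOn.aestronglyMeasurable ?_ measurableSet_Ioi
    intro t ht
    exact ((Real.continuousAt_rpow_const t b (Or.inl (ne_of_gt ht))).mul
      (by fun_prop)).continuousWithinAt
  · refine (ae_restrict_iff' measurableSet_Ioi).2 (Filter.Eventually.of_forall fun t ht => ?_)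
    have ht0 : 0 ≤ t ^ b := Real.rpow_nonneg (le_of_lt ht) _
    rw [Real.norm_of_nonneg (mul_nonneg ht0 (Real.exp_nonneg _)), mul_left_comm, ← Real.exp_add]
    refine mul_le_mul_of_nonneg_left (Real.exp_le_exp.2 ?_) ht0
    nlinarith [sq_nonneg (t / 2 - s)]

open MeasureTheory in
lemma tiltedMoment_pos {b : ℝ} (hb : -1 < b) (s : ℝ) : 0 < tiltedMoment b s := by
  have hpos : ∀ t ∈ Ioi (0 : ℝ), 0 < t ^ b * Real.exp (-t ^ 2 / 2 + s * t) := fun t ht =>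
    mul_pos (Real.rpow_pos_of_pos ht _) (Real.exp_pos _)
  refine (setIntegral_pos_iff_support_of_nonneg_ae ?_ (integrableOn_tiltedMoment hb s)).2 ?_
  · exact (ae_restrict_iff' measurableSet_Ioi).2
      (Filter.Eventually.of_forall fun t ht => (hpos t ht).le)
  · refine lt_of_lt_of_le ?_ (measure_mono (s := Ioi 0) fun t ht => ⟨(hpos t ht).ne', ht⟩)
    simp

open MeasureTheory in
lemma hasDerivAt_tiltedMoment {b : ℝ} (hb : -1 < b) (s : ℝ) :
    HasDerivAt (tiltedMoment b) (tiltedMoment (b + 1) s) s := by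
  have hb1 : -1 < b + 1 := by linarith
  refine (hasDerivAt_integral_of_dominated_loc_of_deriv_le (μ := volume.restrict (Ioi (0 : ℝ)))
    (F := fun s t => t ^ b * Real.exp (-t ^ 2 / 2 + s * t))
    (F' := fun s t => t ^ (b + 1) * Real.exp (-t ^ 2 / 2 + s * t))
    (bound := fun t => t ^ (b + 1) * Real.exp (-t ^ 2 / 2 + (s + 1) * t))
    (Metric.ball_mem_nhds s one_pos)
    (Filter.Eventually.of_forall fun x => (integrableOn_tiltedMoment hb x).aestronglyMeasurable)
    (integrableOn_tiltedMoment hb s) (integrableOn_tiltedMoment hb1 s).aestronglyMeasurable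
    ?_ (integrableOn_tiltedMoment hb1 (s + 1)) ?_).2
  · refine (ae_restrict_iff' measurableSet_Ioi).2 (Filter.Eventually.of_forall fun t ht x hx => ?_)
    have ht0 : (0 : ℝ) < t := ht
    have ht1 : 0 ≤ t ^ (b + 1) := Real.rpow_nonneg (le_of_lt ht) _
    rw [Real.norm_of_nonneg (mul_nonneg ht1 (Real.exp_nonneg _))]
    have : x ≤ s + 1 := by
      rw [Metric.mem_ball, Real.dist_eq] at hx
      linarith [(abs_lt.1 hx).2]
    gcongr
  · refine (ae_restrict_iff' measurableSet_Ioi).2 (Filter.Eventually.of_forall fun t ht x hx => ?_)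
    have h := (((hasDerivAt_id x).mul_const t).const_add (-t ^ 2 / 2)).exp.const_mul (t ^ b)
    refine h.congr_deriv ?_
    rw [Real.rpow_add_one (ne_of_gt ht)]
    simp only [id]
    ring

open MeasureTheory in
/-- Integration by parts for the tilted moments. -/
lemma tiltedMoment_recurrence {b : ℝ} (hb : -1 < b) (s : ℝ) :
    tiltedMoment (b + 2) s = s * tiltedMoment (b + 1) s + (b + 1) * tiltedMoment b s := by
  have hb0 : 0 < b + 1 := by linarith
  have i0 := integrableOn_tiltedMoment hb s
  have i1 := integrableOn_tiltedMoment (b := b + 1) (by linarith) s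
  have i2 := integrableOn_tiltedMoment (b := b + 2) (by linarith) s
  have hlim : Filter.Tendsto (fun t : ℝ => t ^ (b + 1) * Real.exp (-t ^ 2 / 2 + s * t))
      Filter.atTop (nhds 0) := by
    have h1 := tendsto_rpow_mul_exp_neg_mul_atTop_nhds_zero (b + 1) 1 one_pos
    have h2 := h1.const_mul (Real.exp ((s + 1) ^ 2 / 2))
    rw [mul_zero] at h2
    refine squeeze_zero' ?_ ?_ h2
    · filter_upwards [Filter.eventually_ge_atTop 0] with t ht
      positivity
    · filter_upwards [Filter.eventually_ge_atTop 0] with t ht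
      rw [mul_left_comm, ← Real.exp_add]
      refine mul_le_mul_of_nonneg_left (Real.exp_le_exp.2 ?_) (by positivity)
      nlinarith [sq_nonneg (t - (s + 1))]
  have key := integral_Ioi_of_hasDerivAt_of_tendsto (a := 0)
    (f := fun t : ℝ => t ^ (b + 1) * Real.exp (-t ^ 2 / 2 + s * t))
    (f' := fun t => (b + 1) * (t ^ b * Real.exp (-t ^ 2 / 2 + s * t))
      + s * (t ^ (b + 1) * Real.exp (-t ^ 2 / 2 + s * t))
      - t ^ (b + 2) * Real.exp (-t ^ 2 / 2 + s * t))
    ((Real.continuousAt_rpow_const 0 (b + 1) (Or.inr hb0.le)).mul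
      (by fun_prop)).continuousWithinAt
    (by
      intro t ht
      have ht0 : (0 : ℝ) < t := ht
      have h1 := Real.hasDerivAt_rpow_const (x := t) (p := b + 1) (Or.inl ht0.ne')
      have h2 := ((((hasDerivAt_id t).pow 2).neg.div_const 2).add
        ((hasDerivAt_id t).const_mul s)).exp
      refine (h1.mul h2).congr_deriv ?_
      have e2 : t ^ (b + 2) = t ^ b * t ^ 2 := by
        rw [Real.rpow_add ht0]; norm_cast
      rw [Real.rpow_add_one ht0.ne', e2, add_sub_cancel_right]
      simp
      ring)
    (((i0.const_mul _).add (i1.const_mul _)).sub i2) hlim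
  have i01 : IntegrableOn (fun t => (b + 1) * (t ^ b * Real.exp (-t ^ 2 / 2 + s * t))
      + s * (t ^ (b + 1) * Real.exp (-t ^ 2 / 2 + s * t))) (Ioi 0) :=
    (i0.const_mul _).add (i1.const_mul _)
  rw [integral_sub i01 i2,
    integral_add (i0.const_mul _) (i1.const_mul _), integral_const_mul, integral_const_mul,
    Real.zero_rpow hb0.ne', zero_mul, sub_zero] at key
  unfold tiltedMoment
  linarith

open MeasureTheory in
/-- Strict Cauchy–Schwarz inequality for consecutive tilted moments. -/
lemma tiltedMoment_sq_lt {b : ℝ} (hb : -1 < b) (s : ℝ) :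
    tiltedMoment (b + 1) s ^ 2 < tiltedMoment b s * tiltedMoment (b + 2) s := by
  have i0 := integrableOn_tiltedMoment hb s
  have i1 := integrableOn_tiltedMoment (b := b + 1) (by linarith) s
  have i2 := integrableOn_tiltedMoment (b := b + 2) (by linarith) s
  have h0 := tiltedMoment_pos hb s
  set r := tiltedMoment (b + 1) s / tiltedMoment b s with hr
  have hint : IntegrableOn (fun t : ℝ => t ^ (b + 2) * Real.exp (-t ^ 2 / 2 + s * t)
      - 2 * r * (t ^ (b + 1) * Real.exp (-t ^ 2 / 2 + s * t))
      + r ^ 2 * (t ^ b * Real.exp (-t ^ 2 / 2 + s * t))) (Ioi 0) :=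
    (i2.sub (i1.const_mul _)).add (i0.const_mul _)
  have heq : ∀ t ∈ Ioi (0 : ℝ), t ^ (b + 2) * Real.exp (-t ^ 2 / 2 + s * t)
      - 2 * r * (t ^ (b + 1) * Real.exp (-t ^ 2 / 2 + s * t))
      + r ^ 2 * (t ^ b * Real.exp (-t ^ 2 / 2 + s * t))
      = (t - r) ^ 2 * (t ^ b * Real.exp (-t ^ 2 / 2 + s * t)) := by
    intro t ht
    have ht0 : (0 : ℝ) < t := ht
    have e2 : t ^ (b + 2) = t ^ b * t ^ 2 := by
      rw [Real.rpow_add ht0]; norm_cast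
    rw [Real.rpow_add_one ht0.ne', e2]
    ring
  have hw : ∀ t ∈ Ioi (0 : ℝ), 0 < t ^ b * Real.exp (-t ^ 2 / 2 + s * t) := fun t ht =>
    mul_pos (Real.rpow_pos_of_pos ht _) (Real.exp_pos _)
  have hpos := (setIntegral_pos_iff_support_of_nonneg_ae
    ((ae_restrict_iff' measurableSet_Ioi).2 (Filter.Eventually.of_forall fun t ht => by
      simp only [Pi.zero_apply, heq t ht]
      exact mul_nonneg (sq_nonneg _) (hw t ht).le)) hint).2 (by
    have hsub : Ioi (max 0 r) ⊆ (Function.support fun t : ℝ =>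
        t ^ (b + 2) * Real.exp (-t ^ 2 / 2 + s * t)
        - 2 * r * (t ^ (b + 1) * Real.exp (-t ^ 2 / 2 + s * t))
        + r ^ 2 * (t ^ b * Real.exp (-t ^ 2 / 2 + s * t))) ∩ Ioi 0 := by
      intro t ht
      have ht' : 0 < t ∧ r < t := max_lt_iff.1 (mem_Ioi.1 ht)
      refine ⟨?_, ht'.1⟩
      rw [Function.mem_support, heq t ht'.1]
      exact (mul_pos (pow_pos (sub_pos.2 ht'.2) 2) (hw t ht'.1)).ne'
    refine lt_of_lt_of_le ?_ (measure_mono hsub)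
    simp)
  have i21 : IntegrableOn (fun t => t ^ (b + 2) * Real.exp (-t ^ 2 / 2 + s * t)
      - 2 * r * (t ^ (b + 1) * Real.exp (-t ^ 2 / 2 + s * t))) (Ioi 0) :=
    i2.sub (i1.const_mul _)
  rw [integral_add i21 (i0.const_mul _), integral_sub i2 (i1.const_mul _),
    integral_const_mul, integral_const_mul] at hpos
  change 0 < tiltedMoment (b + 2) s - 2 * r * tiltedMoment (b + 1) s
    + r ^ 2 * tiltedMoment b s at hpos
  have h1 : tiltedMoment (b + 1) s = r * tiltedMoment b s := by rw [hr]; field_simp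
  rw [h1] at hpos ⊢
  nlinarith [mul_pos h0 hpos]

/-- The successive derivatives of the increasing fundamental solution of an Ornstein–Uhlenbeck
equation `θ u'' + κ (μ - x) u' - ρ u = 0`, with positivity and strict log-convexity in the order. -/
structure IsOUDerivFamily (κ μ θ ρ : ℝ) (p : ℕ → ℝ → ℝ) : Prop where
  hasDerivAt : ∀ k z, HasDerivAt (p k) (p (k + 1) z) z
  pos : ∀ k z, 0 < p k z
  sq_lt : ∀ k z, p (k + 1) z ^ 2 < p k z * p (k + 2) z
  ode : ∀ k z, θ * p (k + 2) z = κ * (z - μ) * p (k + 1) z + (ρ + k * κ) * p k z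

namespace IsOUDerivFamily

variable {κ μ θ ρ : ℝ} {p : ℕ → ℝ → ℝ}

lemma contDiff (h : IsOUDerivFamily κ μ θ ρ p) (k : ℕ) : ContDiff ℝ 1 (p k) := by
  have hd : deriv (p k) = p (k + 1) := funext fun z => (h.hasDerivAt k z).deriv
  refine contDiff_one_iff_deriv.2 ⟨fun z => (h.hasDerivAt k z).differentiableAt, ?_⟩
  rw [hd]
  exact continuous_iff_continuousAt.2 fun z => (h.hasDerivAt (k + 1) z).continuousAt

lemma iteratedDeriv_eq (h : IsOUDerivFamily κ μ θ ρ p) (k : ℕ) : iteratedDeriv k (p 0) = p k := by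
  induction k with
  | zero => exact iteratedDeriv_zero
  | succ k ih => rw [iteratedDeriv_succ, ih]; exact funext fun z => (h.hasDerivAt k z).deriv

lemma strictMono (h : IsOUDerivFamily κ μ θ ρ p) (k : ℕ) : StrictMono (p k) :=
  strictMono_of_deriv_pos fun z => by rw [(h.hasDerivAt k z).deriv]; exact h.pos _ z

open Filter Topology in
/-- The ratios `p (k + 1) / p k` are strictly concave in `k` at `k = 2`. -/
lemma ratio_concave (h : IsOUDerivFamily κ μ θ ρ p) (hκ : 0 < κ) (hθ : 0 < θ) (z : ℝ) :
    p 2 z ^ 2 * p 3 z + p 1 z * p 2 z * p 4 z < 2 * p 1 z * p 3 z ^ 2 := by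
  set J : ℝ → ℝ := fun z => 2 * p 1 z * p 3 z ^ 2 - p 2 z ^ 2 * p 3 z - p 1 z * p 2 z * p 4 z
    with hJ
  set g : ℝ → ℝ := fun z => Real.exp (-(κ / (2 * θ) * (z - μ) ^ 2)) with hg
  have hgd : ∀ z, HasDerivAt g (g z * -(κ / θ * (z - μ))) z := by
    intro z
    have h1 := ((((hasDerivAt_id z).sub_const μ).pow 2).const_mul (κ / (2 * θ))).neg.exp
    refine h1.congr_deriv ?_
    simp [hg]
    field_simp
  have hJd : ∀ z, HasDerivAt J
      (3 * p 1 z * p 3 z * p 4 z - 2 * p 2 z ^ 2 * p 4 z - p 1 z * p 2 z * p 5 z) z := by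
    intro z
    have d1 := h.hasDerivAt 1 z
    have d2 := h.hasDerivAt 2 z
    have d3 := h.hasDerivAt 3 z
    have d4 := h.hasDerivAt 4 z
    refine ((((d1.const_mul 2).mul (d3.pow 2)).sub ((d2.pow 2).mul d3)).sub
      ((d1.mul d2).mul d4)).congr_deriv ?_
    simp
    ring
  have hWd : ∀ z, HasDerivAt (fun z => g z * (J z / p 1 z))
      (g z * ((p 1 z * p 3 z - p 2 z ^ 2) * (p 1 z * p 4 z - p 2 z * p 3 z) / p 1 z ^ 2)) z := by
    intro z
    have p1 := (h.pos 1 z).ne'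
    refine ((hgd z).mul ((hJd z).div (h.hasDerivAt 1 z) p1)).congr_deriv ?_
    have e3 := h.ode 1 z
    have e4 := h.ode 2 z
    have e5 := h.ode 3 z
    norm_num at e3 e4 e5
    simp only [hJ, Nat.reduceAdd, Pi.div_apply]
    field_simp
    linear_combination g z * ((- p 1 z ^ 2 * p 2 z) * e5 + 2 * p 1 z ^ 2 * p 3 z * e4
      - p 1 z * p 2 z * p 3 z * e3)
  have hmono : StrictMono fun z => g z * (J z / p 1 z) := by
    refine strictMono_of_deriv_pos fun z => ?_
    rw [(hWd z).deriv]
    have h1 := h.pos 1 z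
    have h2 := h.pos 2 z
    have h3 := h.pos 3 z
    have q1 : p 2 z ^ 2 < p 1 z * p 3 z := h.sq_lt 1 z
    have q2 : p 3 z ^ 2 < p 2 z * p 4 z := h.sq_lt 2 z
    have q3 : p 2 z * p 3 z < p 1 z * p 4 z := by
      have a1 := mul_lt_mul_of_pos_left q2 h1
      have a2 := mul_lt_mul_of_pos_right q1 h3
      refine lt_of_mul_lt_mul_left ?_ h2.le
      nlinarith
    exact mul_pos (Real.exp_pos _) (div_pos (mul_pos (sub_pos.2 q1) (sub_pos.2 q3)) (pow_pos h1 2))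
  have hlim : Tendsto (fun z => g z * (J z / p 1 z)) atBot (𝓝 0) := by
    have hg0 : Tendsto g atBot (𝓝 0) := by
      refine Real.tendsto_exp_neg_atTop_nhds_zero.comp ?_
      refine Tendsto.const_mul_atTop (by positivity) ?_
      have hm : Tendsto (fun z : ℝ => z - μ) atBot atBot :=
        tendsto_atBot_add_const_right _ (-μ) tendsto_id
      simpa only [pow_two] using hm.atBot_mul_atBot₀ hm
    have hg1 := hg0.mul_const (3 * p 3 μ ^ 2 + p 2 μ * p 4 μ)
    rw [zero_mul] at hg1
    refine squeeze_zero_norm' ?_ hg1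
    filter_upwards [eventually_le_atBot μ] with z hz
    have h1 := h.pos 1 z
    have h2 := h.pos 2 z
    have h3 := h.pos 3 z
    have h4 := h.pos 4 z
    have m2 : p 2 z ≤ p 2 μ := (h.strictMono 2).monotone hz
    have m3 : p 3 z ≤ p 3 μ := (h.strictMono 3).monotone hz
    have m4 : p 4 z ≤ p 4 μ := (h.strictMono 4).monotone hz
    have q1 : p 2 z ^ 2 < p 1 z * p 3 z := h.sq_lt 1 z
    rw [norm_mul, Real.norm_of_nonneg (Real.exp_nonneg _)]
    refine mul_le_mul_of_nonneg_left ?_ (Real.exp_nonneg _)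
    have b1 : p 3 z ^ 2 ≤ p 3 μ ^ 2 := by gcongr
    have n2 := (h.pos 2 μ).le
    have b2 : p 2 z * p 4 z ≤ p 2 μ * p 4 μ := by gcongr
    have b3 := mul_lt_mul_of_pos_right q1 h3
    rw [Real.norm_eq_abs, abs_le, le_div_iff₀ h1, div_le_iff₀ h1]
    have c1 := mul_le_mul_of_nonneg_left b1 h1.le
    have c2 := mul_le_mul_of_nonneg_left b2 h1.le
    have c3 : 0 < p 2 z ^ 2 * p 3 z := by positivity
    have c4 : 0 < p 1 z * (p 2 z * p 4 z) := by positivity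
    have c5 : 0 < p 1 z * p 3 z ^ 2 := by positivity
    constructor <;> simp only [hJ] <;> nlinarith
  have hpos : 0 < g z * (J z / p 1 z) :=
    (hmono.monotone.le_of_tendsto hlim (z - 1)).trans_lt (hmono (sub_one_lt z))
  have h1 := (div_pos_iff_of_pos_right (h.pos 1 z)).1 ((pos_iff_pos_of_mul_pos hpos).1
    (Real.exp_pos _))
  simp only [hJ] at h1
  linarith

end IsOUDerivFamily

/-- The free-boundary ODE expressed through the derivatives of the fundamental solution. -/
theorem exists_unique_free_boundary {κ μ θ ρ β K₀ T xt : ℝ} {p : ℕ → ℝ → ℝ}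
    (h : IsOUDerivFamily κ μ θ ρ p) (hκ : 0 < κ) (hθ : 0 < θ) (hρ : 0 < ρ) (hβ : 0 < β)
    (hT : 0 < T) {A v : ℝ → ℝ → ℝ}
    (hA : ∀ y z, A y z = K₀ - z + β * (ρ + 2 * κ) / ρ * y)
    (hv : ∀ y z, v y z = β * ((p 0 z * p 2 z - p 1 z ^ 2) *
      ((ρ + 2 * κ) / ρ * p 1 z + (A y z * p 2 z + p 1 z))) /
      (p 0 z * (A y z * (p 1 z * p 3 z - p 2 z ^ 2) + (p 0 z * p 3 z - p 1 z * p 2 z))))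
    (hxt : A T xt + p 0 xt / p 1 xt = 0) :
    ∃ F : ℝ → ℝ, F T = xt ∧ (∀ y ∈ Icc 0 T, HasDerivAt F (v y (F y)) y) ∧
      (∀ y ∈ Icc 0 T, β ≤ v y (F y)) ∧
      ∀ G : ℝ → ℝ, G T = xt → (∀ y ∈ Icc 0 T, HasDerivAt G (v y (G y)) y) →
        EqOn F G (Icc 0 T) := by
  have h0 := h.pos 0
  have h1 := h.pos 1
  have h2 := h.pos 2
  have q0 : ∀ z, 0 < p 0 z * p 2 z - p 1 z ^ 2 := fun z => sub_pos.2 (h.sq_lt 0 z)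
  have q1 : ∀ z, 0 < p 1 z * p 3 z - p 2 z ^ 2 := fun z => sub_pos.2 (h.sq_lt 1 z)
  have q2 : ∀ z, 0 < p 2 z * p 4 z - p 3 z ^ 2 := fun z => sub_pos.2 (h.sq_lt 2 z)
  have c0 := h.contDiff 0
  have c1 := h.contDiff 1
  have c2 := h.contDiff 2
  have c3 := h.contDiff 3
  have cq0 := (c0.mul c2).sub (c1.pow 2)
  have cq1 := (c1.mul c3).sub (c2.pow 2)
  have ce := ((c0.mul c3).sub (c1.mul c2)).div cq1 fun z => (q1 z).ne'
  have cd := c0.mul cq1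
  have hd : ∀ z, p 0 z * (p 1 z * p 3 z - p 2 z ^ 2) ≠ 0 := fun z => (mul_pos (h0 z) (q1 z)).ne'
  set e : ℝ → ℝ := fun z => (p 0 z * p 3 z - p 1 z * p 2 z) / (p 1 z * p 3 z - p 2 z ^ 2) with he
  set b : ℝ → ℝ := fun z => p 0 z / p 1 z with hb
  set γ : ℝ → ℝ := fun z => β * ((p 0 z * p 2 z - p 1 z ^ 2) * p 2 z) /
    (p 0 z * (p 1 z * p 3 z - p 2 z ^ 2)) with hγ
  set δ : ℝ → ℝ := fun z => β * ((p 0 z * p 2 z - p 1 z ^ 2) *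
    (2 * (ρ + κ) / ρ * p 1 z - e z * p 2 z)) /
    (p 0 z * (p 1 z * p 3 z - p 2 z ^ 2)) with hδ
  have hed : ∀ z, HasDerivAt e (1 - (p 0 z * p 2 z - p 1 z ^ 2) * (p 2 z * p 4 z - p 3 z ^ 2) /
      (p 1 z * p 3 z - p 2 z ^ 2) ^ 2) z := by
    intro z
    have d0 := h.hasDerivAt 0 z
    have d1 := h.hasDerivAt 1 z
    have d2 := h.hasDerivAt 2 z
    have d3 := h.hasDerivAt 3 z
    refine (((d0.mul d3).sub (d1.mul d2)).div ((d1.mul d3).sub (d2.pow 2))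
      (q1 z).ne').congr_deriv ?_
    have := (q1 z).ne'
    simp
    field_simp
    ring
  have hbd : ∀ z, HasDerivAt b (1 - p 0 z * p 2 z / p 1 z ^ 2) z := by
    intro z
    refine ((h.hasDerivAt 0 z).div (h.hasDerivAt 1 z) (h1 z).ne').congr_deriv ?_
    have := (h1 z).ne'
    simp
    field_simp
  have heb : ∀ z, e z - b z = p 2 z * (p 0 z * p 2 z - p 1 z ^ 2) /
      (p 1 z * (p 1 z * p 3 z - p 2 z ^ 2)) := by
    intro z
    have a1 := (q1 z).ne'
    have a2 := (h1 z).ne'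
    simp only [he, hb]
    rw [div_sub_div _ _ a1 a2, div_eq_div_iff (mul_ne_zero a1 a2) (mul_ne_zero a2 a1)]
    ring
  have hval : ∀ z, γ z + δ z / (e z - b z) =
      β * (2 * (ρ + κ) / ρ * p 1 z ^ 2 - p 0 z * p 2 z) / (p 0 z * p 2 z) := by
    intro z
    have a1 := (q1 z).ne'
    have a2 := (h1 z).ne'
    have a3 := (q0 z).ne'
    have a4 := (h0 z).ne'
    have a5 := (h2 z).ne'
    rw [heb]
    simp only [hγ, hδ, he]
    field_simp
    ring
  refine exists_unique_backward_solution (γ := γ) (δ := δ) (e := e) (b := b) (K₀ := K₀)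
    (m := β * (ρ + 2 * κ) / ρ) ?_ ?_ ce (c0.div c1 fun z => (h1 z).ne') (by positivity) hβ hT
    ?_ ?_ (fun z => div_pos (h0 z) (h1 z)) ?_ ?_ ?_ ?_ ?_ (by rw [← hA]; exact hxt)
  · exact (contDiff_const.mul (cq0.mul c2)).div cd hd
  · exact (contDiff_const.mul (cq0.mul ((contDiff_const.mul c1).sub (ce.mul c2)))).div cd hd
  · exact fun z => div_pos (mul_pos hβ (mul_pos (q0 z) (h2 z))) (mul_pos (h0 z) (q1 z))
  · intro z
    refine div_pos (mul_pos hβ (mul_pos (q0 z) ?_)) (mul_pos (h0 z) (q1 z))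
    have e2 := h.ode 0 z
    have e3 := h.ode 1 z
    norm_num at e2 e3
    have e4 := h.ode 2 z
    norm_num at e4
    have hJ := h.ratio_concave hκ hθ z
    have hid : 2 * (ρ + κ) / ρ * p 1 z - e z * p 2 z =
        θ * (2 * p 1 z * p 3 z ^ 2 - (p 2 z ^ 2 * p 3 z + p 1 z * p 2 z * p 4 z)) /
          (ρ * (p 1 z * p 3 z - p 2 z ^ 2)) := by
      have a1 := (q1 z).ne'
      simp only [he]
      field_simp
      linear_combination (p 2 z * p 3 z) * e2 - 2 * p 1 z * p 3 z * e3 + p 1 z * p 2 z * e4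
    rw [hid]
    exact div_pos (mul_pos hθ (sub_pos.2 hJ)) (mul_pos hρ (q1 z))
  · intro z
    rw [← sub_pos, heb]
    exact div_pos (mul_pos (h2 z) (q0 z)) (mul_pos (h1 z) (q1 z))
  · intro z
    rw [(hed z).deriv]
    have := div_pos (mul_pos (q0 z) (q2 z)) (pow_pos (q1 z) 2)
    linarith
  · intro z
    rw [(hbd z).deriv, hval]
    have a2 := (h1 z).ne'
    have a4 := (h0 z).ne'
    have a5 := (h2 z).ne'
    rw [← sub_pos]
    have : β * (ρ + 2 * κ) / ρ - β * (2 * (ρ + κ) / ρ * p 1 z ^ 2 - p 0 z * p 2 z) /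
        (p 0 z * p 2 z) * (1 - (1 - p 0 z * p 2 z / p 1 z ^ 2)) =
        β * (p 0 z * p 2 z - p 1 z ^ 2) / p 1 z ^ 2 := by
      field_simp
      ring
    rw [this]
    exact div_pos (mul_pos hβ (q0 z)) (pow_pos (h1 z) 2)
  · intro z
    rw [hval, le_div_iff₀ (mul_pos (h0 z) (h2 z))]
    refine mul_le_mul_of_nonneg_left ?_ hβ.le
    have e2 := h.ode 0 z
    have e3 := h.ode 1 z
    norm_num at e2 e3
    have hid : 2 * (ρ + κ) / ρ * p 1 z ^ 2 - p 0 z * p 2 z - p 0 z * p 2 z =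
        2 * θ * (p 1 z * p 3 z - p 2 z ^ 2) / ρ := by
      field_simp
      linear_combination 2 * p 2 z * e2 - 2 * p 1 z * e3
    have := div_pos (mul_pos (mul_pos two_pos hθ) (q1 z)) hρ
    linarith
  · intro y z hpos
    rw [hv, ← hA]
    rw [← hA] at hpos
    have a1 := (q1 z).ne'
    have a4 := (h0 z).ne'
    have a6 : A y z + e z ≠ 0 := hpos.ne'
    have a7 : A y z * (p 1 z * p 3 z - p 2 z ^ 2) + (p 0 z * p 3 z - p 1 z * p 2 z) =
        (p 1 z * p 3 z - p 2 z ^ 2) * (A y z + e z) := by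
      simp only [he]
      field_simp
    rw [a7]
    simp only [hγ, hδ]
    field_simp
    ring

/-- The `k`-th derivative of `psi`, written as a Laplace-type integral. -/
noncomputable def psiDeriv (κ μ σ ρ : ℝ) (k : ℕ) (z : ℝ) : ℝ :=
  (Real.sqrt (2 * κ) / σ) ^ k / Real.Gamma (ρ / κ) *
    tiltedMoment (ρ / κ - 1 + k) (Real.sqrt (2 * κ) / σ * (z - μ))

lemma psi_eq_psiDeriv {κ σ : ℝ} (hκ : 0 < κ) (hσ : 0 < σ) (μ ρ : ℝ) :
    psi κ μ σ ρ = psiDeriv κ μ σ ρ 0 := by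
  funext z
  have hs : Real.sqrt (2 * κ) ^ 2 = 2 * κ := Real.sq_sqrt (by positivity)
  have hexp : Real.exp (κ * (z - μ) ^ 2 / (2 * σ ^ 2)) *
      Real.exp (-(-((z - μ) / σ) * Real.sqrt (2 * κ)) ^ 2 / 4) = 1 := by
    rw [← Real.exp_add, Real.exp_eq_one_iff]
    rw [mul_pow, hs]
    field_simp
    ring
  have hint : ∀ t : ℝ, -t ^ 2 / 2 - -((z - μ) / σ) * Real.sqrt (2 * κ) * t =
      -t ^ 2 / 2 + Real.sqrt (2 * κ) / σ * (z - μ) * t := fun t => by ring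
  simp only [psi, psiDeriv, Dcyl, tiltedMoment, neg_neg, hint, Nat.cast_zero, add_zero, pow_zero]
  rw [← mul_assoc, mul_div_assoc', hexp]

lemma isOUDerivFamily_psiDeriv {κ σ ρ : ℝ} (hκ : 0 < κ) (hσ : 0 < σ) (hρ : 0 < ρ) (μ : ℝ) :
    IsOUDerivFamily κ μ (σ ^ 2 / 2) ρ (psiDeriv κ μ σ ρ) := by
  have ha : 0 < ρ / κ := div_pos hρ hκ
  have hΓ := Real.Gamma_pos_of_pos ha
  have hs : Real.sqrt (2 * κ) ^ 2 = 2 * κ := Real.sq_sqrt (by positivity)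
  have hl : 0 < Real.sqrt (2 * κ) / σ := div_pos (Real.sqrt_pos.2 (by positivity)) hσ
  have hl2 : σ ^ 2 / 2 * (Real.sqrt (2 * κ) / σ) ^ 2 = κ := by
    rw [div_pow, hs]
    field_simp
  have hb : ∀ k : ℕ, -1 < ρ / κ - 1 + k := fun k => by
    have := k.cast_nonneg (α := ℝ)
    linarith
  have c1 : ∀ k : ℕ, ρ / κ - 1 + (k + 1 : ℕ) = ρ / κ - 1 + k + 1 := fun k => by push_cast; ring
  have c2 : ∀ k : ℕ, ρ / κ - 1 + (k + 2 : ℕ) = ρ / κ - 1 + k + 2 := fun k => by push_cast; ring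
  unfold psiDeriv
  set l := Real.sqrt (2 * κ) / σ
  refine ⟨fun k z => ?_, fun k z => ?_, fun k z => ?_, fun k z => ?_⟩
  · have hlin : HasDerivAt (fun z => l * (z - μ)) (l * 1) z :=
      ((hasDerivAt_id z).sub_const μ).const_mul l
    refine (((hasDerivAt_tiltedMoment (hb k) (l * (z - μ))).comp z hlin).const_mul
      (l ^ k / Real.Gamma (ρ / κ))).congr_deriv ?_
    rw [c1 k]
    ring
  · exact mul_pos (by positivity) (tiltedMoment_pos (hb k) _)
  · have hlt := mul_lt_mul_of_pos_left (tiltedMoment_sq_lt (hb k) (l * (z - μ)))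
      (show 0 < (l ^ (k + 1) / Real.Gamma (ρ / κ)) ^ 2 by positivity)
    rw [c1 k, c2 k]
    linear_combination hlt
  · rw [c1 k, c2 k, tiltedMoment_recurrence (hb k)]
    have hc : κ * (ρ / κ - 1 + k + 1) = ρ + k * κ := by field_simp; ring
    rw [← hc]
    generalize tiltedMoment (ρ / κ - 1 + k) (l * (z - μ)) = m₀
    generalize tiltedMoment (ρ / κ - 1 + k + 1) (l * (z - μ)) = m₁
    linear_combination (l ^ k / Real.Gamma (ρ / κ) *
      (l * (z - μ) * m₁ + (ρ / κ - 1 + k + 1) * m₀)) * hl2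

/-- The free-boundary ODE `F̃'(y) = β N(y,F̃(y))/D(y,F̃(y))` with terminal condition
`F̃(ybar) = x̃` (the unique zero of `H`) has a unique solution on `[0, ybar]`, and this
solution satisfies `F̃'(y) ≥ β` there. -/
theorem stmt13 (κ σ ρ μ β c ybar xt : ℝ) (hκ : 0 < κ) (hσ : 0 < σ) (hρ : 0 < ρ)
    (hβ : 0 < β) (hc : 0 ≤ c) (hybar : 0 < ybar)
    (hxt : Hfun κ μ σ ρ β c ybar xt = 0) :
    ∃ F : ℝ → ℝ,
      F ybar = xt ∧
      (∀ y ∈ Set.Icc (0 : ℝ) ybar,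
        HasDerivAt F (β * Nfun κ μ σ ρ β c y (F y) / Dfun κ μ σ ρ β c y (F y)) y) ∧
      (∀ y ∈ Set.Icc (0 : ℝ) ybar,
        β ≤ β * Nfun κ μ σ ρ β c y (F y) / Dfun κ μ σ ρ β c y (F y)) ∧
      ∀ G : ℝ → ℝ, G ybar = xt →
        (∀ y ∈ Set.Icc (0 : ℝ) ybar,
          HasDerivAt G (β * Nfun κ μ σ ρ β c y (G y) / Dfun κ μ σ ρ β c y (G y)) y) →
        Set.EqOn F G (Set.Icc (0 : ℝ) ybar) := by
  have h := isOUDerivFamily_psiDeriv hκ hσ hρ μ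
  have hψ := psi_eq_psiDeriv hκ hσ μ ρ
  have hit : ∀ k z, iteratedDeriv k (psi κ μ σ ρ) z = psiDeriv κ μ σ ρ k z := fun k z => by
    rw [hψ, h.iteratedDeriv_eq]
  have hd : ∀ z, deriv (psi κ μ σ ρ) z = psiDeriv κ μ σ ρ 1 z := fun z => by
    rw [← iteratedDeriv_one, hit]
  have hQ : ∀ k z, Q κ μ σ ρ k z = psiDeriv κ μ σ ρ k z * psiDeriv κ μ σ ρ (k + 2) z -
      psiDeriv κ μ σ ρ (k + 1) z ^ 2 := fun k z => by simp only [Q, hit]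
  have hQd : ∀ z, deriv (Q κ μ σ ρ 0) z = psiDeriv κ μ σ ρ 0 z * psiDeriv κ μ σ ρ 3 z -
      psiDeriv κ μ σ ρ 1 z * psiDeriv κ μ σ ρ 2 z := fun z => by
    rw [funext (hQ 0)]
    refine ((((h.hasDerivAt 0 z).mul (h.hasDerivAt 2 z)).sub
      ((h.hasDerivAt 1 z).pow 2)).congr_deriv ?_).deriv
    simp
    ring
  refine exists_unique_free_boundary (K₀ := (ρ + κ) * c - μ * κ / ρ)
    (A := fun y z => (ρ + κ) * (c - Rt κ μ ρ β z y))
    (v := fun y z => β * Nfun κ μ σ ρ β c y z / Dfun κ μ σ ρ β c y z)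
    h hκ (by positivity) hρ hβ hybar ?_ ?_ ?_
  · intro y z
    simp only [Rt]
    field_simp
    ring
  · intro y z
    simp only [Nfun, Dfun, hit, hd, hQ, hQd, congrFun hψ z]
  · have h1 := (h.pos 1 xt).ne'
    have hk : ρ + κ ≠ 0 := by positivity
    simp only [Hfun, hd, congrFun hψ xt] at hxt
    have h2 : (ρ + κ) * (ρ + κ)⁻¹ = 1 := mul_inv_cancel₀ hk
    rw [← sub_eq_zero, sub_zero, ← mul_left_inj' h1, add_mul, div_mul_cancel₀ _ h1, zero_mul]
    linear_combination (ρ + κ) * hxt - psiDeriv κ μ σ ρ 0 xt * h2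
end

section
/- The free boundary F(y) = F̃(y) − βy, where F̃ solves the free-boundary ODE with F̃' ≥ β and F̃(ȳ) = x̃, is strictly increasing on [0,ȳ] and satisfies F(y) ≥ cρ + (κβ/(ρ+κ))y ≥ cρ for all y ∈ [0,ȳ]. -/
open Set

open MeasureTheory ProbabilityTheory Filter Topology

lemma integrableOn_rpow_mul_exp_neg_sq_half_add {p : ℝ} (hp : -1 < p) (b : ℝ) :
    IntegrableOn (fun t : ℝ => t ^ p * Real.exp (-t ^ 2 / 2 + b * t)) (Ioi 0) := by
  have h := (integrableOn_rpow_mul_exp_neg_mul_sq (b := 1 / 4) (by norm_num) hp).const_mul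
    (Real.exp (b ^ 2))
  refine Integrable.mono' h (by fun_prop) ?_
  refine (ae_restrict_iff' measurableSet_Ioi).2 (Eventually.of_forall fun t ht => ?_)
  have ht0 : 0 < t := ht
  have h0 : 0 < t ^ p := Real.rpow_pos_of_pos ht0 p
  rw [Real.norm_of_nonneg (by positivity), mul_left_comm, ← Real.exp_add]
  refine mul_le_mul_of_nonneg_left (Real.exp_le_exp.2 ?_) h0.le
  nlinarith [sq_nonneg (t / 2 - b)]

lemma tendsto_rpow_mul_exp_neg_sq_half_add (p b : ℝ) :
    Tendsto (fun t : ℝ => t ^ p * Real.exp (-t ^ 2 / 2 + b * t)) atTop (𝓝 0) := by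
  have h := (tendsto_rpow_mul_exp_neg_mul_atTop_nhds_zero p 1 one_pos).const_mul
    (Real.exp ((b + 1) ^ 2 / 2))
  rw [mul_zero] at h
  refine squeeze_zero' ?_ ?_ h
  · filter_upwards [eventually_gt_atTop 0] with t ht
    positivity
  · filter_upwards [eventually_gt_atTop 0] with t ht
    rw [mul_left_comm, ← Real.exp_add]
    refine mul_le_mul_of_nonneg_left (Real.exp_le_exp.2 ?_) (by positivity)
    nlinarith [sq_nonneg (t - (b + 1))]

lemma integral_rpow_mul_exp_neg_sq_half_add_recurrence {a : ℝ} (ha : 0 < a) (b : ℝ) :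
    ∫ t in Ioi (0 : ℝ), (a * t ^ (a - 1) + b * t ^ a - t ^ (a + 1)) *
      Real.exp (-t ^ 2 / 2 + b * t) = 0 := by
  have hint : IntegrableOn (fun t : ℝ => (a * t ^ (a - 1) + b * t ^ a - t ^ (a + 1)) *
      Real.exp (-t ^ 2 / 2 + b * t)) (Ioi 0) := by
    have h1 := (integrableOn_rpow_mul_exp_neg_sq_half_add (p := a - 1) (by linarith) b).const_mul a
    have h2 := (integrableOn_rpow_mul_exp_neg_sq_half_add (p := a) (by linarith) b).const_mul b
    have h3 := integrableOn_rpow_mul_exp_neg_sq_half_add (p := a + 1) (by linarith) b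
    refine ((h1.add h2).sub h3).congr (Eventually.of_forall fun t => ?_)
    simp only [Pi.add_apply, Pi.sub_apply]
    ring
  have h := integral_Ioi_of_hasDerivAt_of_tendsto
    (f := fun t : ℝ => t ^ a * Real.exp (-t ^ 2 / 2 + b * t)) (a := 0) ?_ ?_ hint
    (tendsto_rpow_mul_exp_neg_sq_half_add a b)
  · simpa [Real.zero_rpow ha.ne'] using h
  · have : ContinuousAt (fun t : ℝ => t ^ a) 0 := Real.continuousAt_rpow_const _ _ (Or.inr ha.le)
    exact (this.mul (by fun_prop)).continuousWithinAt
  · intro t ht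
    have ht0 : 0 < t := ht
    have h1 := Real.hasDerivAt_rpow_const (p := a) (Or.inl ht0.ne')
    have h2 : HasDerivAt (fun t : ℝ => -t ^ 2 / 2 + b * t) (-t + b) t := by
      have := (((hasDerivAt_id t).pow 2).neg.div_const 2).add ((hasDerivAt_id t).const_mul b)
      refine this.congr_deriv ?_
      simp
      ring
    refine (h1.mul h2.exp).congr_deriv ?_
    rw [Real.rpow_add_one ht0.ne']
    ring

section Moments

variable {Ω : Type*} [MeasurableSpace Ω] {ν : Measure Ω} {X : Ω → ℝ}

lemma integrable_pow_mul_exp_of_integrableExpSet_eq_univ (hX : integrableExpSet X ν = univ)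
    (x : ℝ) (k : ℕ) : Integrable (fun ω => X ω ^ k * Real.exp (x * X ω)) ν :=
  integrable_pow_mul_exp_of_mem_interior_integrableExpSet (by simp [hX]) k

lemma integral_pos_of_ae_pos [NeZero ν] {f : Ω → ℝ} (hf : Integrable f ν)
    (hpos : ∀ᵐ ω ∂ν, 0 < f ω) : 0 < ∫ ω, f ω ∂ν := by
  have h0 : 0 ≤ᵐ[ν] f := hpos.mono fun ω h => h.le
  refine (integral_nonneg_of_ae h0).lt_of_ne fun h => ?_
  have h1 := (integral_eq_zero_iff_of_nonneg_ae h0 hf).1 h.symm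
  obtain ⟨ω, h2, h3⟩ := (hpos.and h1).exists
  exact h2.ne' h3

lemma iteratedDeriv_mgf_pos [NeZero ν] (hX : integrableExpSet X ν = univ)
    (hpos : ∀ᵐ ω ∂ν, 0 < X ω) (k : ℕ) (x : ℝ) : 0 < iteratedDeriv k (mgf X ν) x := by
  rw [iteratedDeriv_mgf (by simp [hX])]
  refine integral_pos_of_ae_pos (integrable_pow_mul_exp_of_integrableExpSet_eq_univ hX x k) ?_
  filter_upwards [hpos] with ω h
  positivity

lemma iteratedDeriv_mgf_sq_lt [NeZero ν] (hX : integrableExpSet X ν = univ)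
    (hpos : ∀ᵐ ω ∂ν, 0 < X ω) (hne : ∀ r, ∀ᵐ ω ∂ν, X ω ≠ r) (k : ℕ) (x : ℝ) :
    iteratedDeriv (k + 1) (mgf X ν) x ^ 2 <
      iteratedDeriv k (mgf X ν) x * iteratedDeriv (k + 2) (mgf X ν) x := by
  have hk := iteratedDeriv_mgf_pos hX hpos k x
  have hi := integrable_pow_mul_exp_of_integrableExpSet_eq_univ hX x
  have hE : ∀ j, iteratedDeriv j (mgf X ν) x = ∫ ω, X ω ^ j * Real.exp (x * X ω) ∂ν :=
    fun j => iteratedDeriv_mgf (by simp [hX]) j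
  set m := fun j => iteratedDeriv j (mgf X ν) x
  set r := m (k + 1) / m k with hr
  have hfun : ∀ ω, X ω ^ (k + 2) * Real.exp (x * X ω) -
      2 * r * (X ω ^ (k + 1) * Real.exp (x * X ω)) + r ^ 2 * (X ω ^ k * Real.exp (x * X ω)) =
      X ω ^ k * (X ω - r) ^ 2 * Real.exp (x * X ω) := fun ω => by ring
  have hint := ((hi (k + 2)).sub ((hi (k + 1)).const_mul (2 * r))).add
    ((hi k).const_mul (r ^ 2))
  have h := integral_pos_of_ae_pos hint ?_
  · simp only [Pi.add_apply, Pi.sub_apply] at h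
    rw [integral_add, integral_sub, integral_const_mul, integral_const_mul, ← hE, ← hE, ← hE] at h
    · change 0 < m (k + 2) - 2 * r * m (k + 1) + r ^ 2 * m k at h
      change 0 < m k at hk
      change m (k + 1) ^ 2 < m k * m (k + 2)
      have h2 : m (k + 1) = r * m k := by rw [hr]; field_simp
      rw [h2] at h ⊢
      nlinarith [mul_pos hk h]
    · exact hi _
    · exact (hi _).const_mul _
    · exact (hi _).sub ((hi _).const_mul _)
    · exact (hi _).const_mul _
  · filter_upwards [hpos, hne r] with ω h1 h2
    simp only [Pi.add_apply, Pi.sub_apply]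
    rw [hfun]
    have : 0 < (X ω - r) ^ 2 := by
      have := sub_ne_zero.2 h2
      positivity
    positivity

end Moments

/-- The measure on `(0, ∞)` representing `psi` as a moment generating function. -/
noncomputable def psiMeasure (κ μ σ ρ : ℝ) : Measure ℝ :=
  (volume.restrict (Ioi 0)).withDensity fun t => ENNReal.ofReal
    ((Real.Gamma (ρ / κ))⁻¹ * (t ^ (ρ / κ - 1) *
      Real.exp (-t ^ 2 / 2 + -(Real.sqrt (2 * κ) / σ * μ) * t)))

section Psi

variable {κ μ σ ρ : ℝ}

lemma psiMeasure_density_pos (hκ : 0 < κ) (hρ : 0 < ρ) {t : ℝ} (ht : t ∈ Ioi (0 : ℝ)) :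
    0 < (Real.Gamma (ρ / κ))⁻¹ * (t ^ (ρ / κ - 1) *
      Real.exp (-t ^ 2 / 2 + -(Real.sqrt (2 * κ) / σ * μ) * t)) := by
  have ht0 : 0 < t := ht
  have := Real.Gamma_pos_of_pos (div_pos hρ hκ)
  positivity

lemma integral_psiMeasure (hκ : 0 < κ) (hρ : 0 < ρ) (f : ℝ → ℝ) :
    ∫ t, f t ∂(psiMeasure κ μ σ ρ) = ∫ t in Ioi (0 : ℝ), ((Real.Gamma (ρ / κ))⁻¹ *
      (t ^ (ρ / κ - 1) *
        Real.exp (-t ^ 2 / 2 + -(Real.sqrt (2 * κ) / σ * μ) * t))) * f t := by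
  rw [psiMeasure, integral_withDensity_eq_integral_toReal_smul (by fun_prop) (by simp)]
  refine setIntegral_congr_fun measurableSet_Ioi fun t ht => ?_
  simp only [smul_eq_mul]
  rw [ENNReal.toReal_ofReal (psiMeasure_density_pos hκ hρ ht).le]

lemma integrableExpSet_psiMeasure (hκ : 0 < κ) (hρ : 0 < ρ) :
    integrableExpSet (fun t => Real.sqrt (2 * κ) / σ * t) (psiMeasure κ μ σ ρ) = univ := by
  refine eq_univ_of_forall fun x => ?_
  change Integrable _ _
  rw [psiMeasure, integrable_withDensity_iff_integrable_smul' (by fun_prop) (by simp)]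
  have h := (integrableOn_rpow_mul_exp_neg_sq_half_add (p := ρ / κ - 1)
    (by linarith [div_pos hρ hκ]) (Real.sqrt (2 * κ) / σ * (x - μ))).const_mul
      (Real.Gamma (ρ / κ))⁻¹
  refine IntegrableOn.congr_fun h (fun t ht => ?_) measurableSet_Ioi
  simp only [smul_eq_mul]
  rw [ENNReal.toReal_ofReal (psiMeasure_density_pos hκ hρ ht).le]
  have h1 : Real.exp (-t ^ 2 / 2 + Real.sqrt (2 * κ) / σ * (x - μ) * t) =
      Real.exp (-t ^ 2 / 2 + -(Real.sqrt (2 * κ) / σ * μ) * t) *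
        Real.exp (x * (Real.sqrt (2 * κ) / σ * t)) := by
    rw [← Real.exp_add]
    ring_nf
  rw [h1]
  ring

lemma psi_eq_mgf (hκ : 0 < κ) (hσ : 0 < σ) (hρ : 0 < ρ) :
    psi κ μ σ ρ = mgf (fun t => Real.sqrt (2 * κ) / σ * t) (psiMeasure κ μ σ ρ) := by
  funext x
  rw [mgf, integral_psiMeasure hκ hρ, psi, Dcyl, ← mul_assoc, ← mul_div_assoc, ← Real.exp_add,
    ← integral_const_mul]
  have hsq : (-((x - μ) / σ) * Real.sqrt (2 * κ)) ^ 2 = 2 * κ * (x - μ) ^ 2 / σ ^ 2 := by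
    rw [mul_pow, Real.sq_sqrt (by positivity)]
    ring
  have h0 : κ * (x - μ) ^ 2 / (2 * σ ^ 2) + -(-((x - μ) / σ) * Real.sqrt (2 * κ)) ^ 2 / 4 = 0 := by
    rw [hsq]
    field_simp
    ring
  rw [h0, Real.exp_zero]
  refine setIntegral_congr_fun measurableSet_Ioi fun t ht => ?_
  have h1 : Real.exp (-t ^ 2 / 2 - -((x - μ) / σ) * Real.sqrt (2 * κ) * t) =
      Real.exp (-t ^ 2 / 2 + -(Real.sqrt (2 * κ) / σ * μ) * t) *
        Real.exp (x * (Real.sqrt (2 * κ) / σ * t)) := by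
    rw [← Real.exp_add]
    ring_nf
  simp only [neg_neg]
  rw [h1]
  ring

lemma psiMeasure_ae_pos : ∀ᵐ t ∂(psiMeasure κ μ σ ρ), 0 < t :=
  (withDensity_absolutelyContinuous _ _).ae_le (ae_restrict_mem measurableSet_Ioi)

lemma psiMeasure_ae_ne (r : ℝ) : ∀ᵐ t ∂(psiMeasure κ μ σ ρ), t ≠ r :=
  (withDensity_absolutelyContinuous _ _).ae_le (ae_restrict_of_ae (Measure.ae_ne volume r))

lemma psiMeasure_neZero (hκ : 0 < κ) (hρ : 0 < ρ) : NeZero (psiMeasure κ μ σ ρ) := by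
  refine ⟨fun h => ?_⟩
  rw [psiMeasure, withDensity_eq_zero_iff (by fun_prop)] at h
  have h1 : ∀ᵐ t ∂(volume.restrict (Ioi (0 : ℝ))), False := by
    filter_upwards [h, ae_restrict_mem measurableSet_Ioi] with t h1 ht
    have := psiMeasure_density_pos (μ := μ) (σ := σ) hκ hρ ht
    simp only [Pi.zero_apply, ENNReal.ofReal_eq_zero] at h1
    linarith
  rw [ae_iff] at h1
  simp at h1

lemma scaled_psiMeasure_ae_pos (hκ : 0 < κ) (hσ : 0 < σ) :
    ∀ᵐ t ∂(psiMeasure κ μ σ ρ), 0 < Real.sqrt (2 * κ) / σ * t := by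
  filter_upwards [psiMeasure_ae_pos] with t ht
  positivity

lemma iteratedDeriv_psi_pos (hκ : 0 < κ) (hσ : 0 < σ) (hρ : 0 < ρ) (k : ℕ) (x : ℝ) :
    0 < iteratedDeriv k (psi κ μ σ ρ) x := by
  have := psiMeasure_neZero (μ := μ) (σ := σ) hκ hρ
  rw [psi_eq_mgf hκ hσ hρ]
  exact iteratedDeriv_mgf_pos (integrableExpSet_psiMeasure hκ hρ)
    (scaled_psiMeasure_ae_pos hκ hσ) k x

lemma Q_pos (hκ : 0 < κ) (hσ : 0 < σ) (hρ : 0 < ρ) (k : ℕ) (x : ℝ) :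
    0 < Q κ μ σ ρ k x := by
  have := psiMeasure_neZero (μ := μ) (σ := σ) hκ hρ
  rw [Q, psi_eq_mgf hκ hσ hρ, sub_pos]
  refine iteratedDeriv_mgf_sq_lt (integrableExpSet_psiMeasure hκ hρ)
    (scaled_psiMeasure_ae_pos hκ hσ) (fun r => ?_) k x
  filter_upwards [psiMeasure_ae_ne (r / (Real.sqrt (2 * κ) / σ))] with t ht h
  refine ht ?_
  rw [← h]
  field_simp

lemma analyticOnNhd_iteratedDeriv_psi (hκ : 0 < κ) (hσ : 0 < σ) (hρ : 0 < ρ) (k : ℕ) :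
    AnalyticOnNhd ℝ (iteratedDeriv k (psi κ μ σ ρ)) univ := by
  have h := analyticOnNhd_iteratedDeriv_mgf (μ := psiMeasure κ μ σ ρ)
    (X := fun t => Real.sqrt (2 * κ) / σ * t) k
  rwa [integrableExpSet_psiMeasure hκ hρ, interior_univ, ← psi_eq_mgf hκ hσ hρ] at h

lemma hasDerivAt_iteratedDeriv_psi (hκ : 0 < κ) (hσ : 0 < σ) (hρ : 0 < ρ) (k : ℕ) (x : ℝ) :
    HasDerivAt (iteratedDeriv k (psi κ μ σ ρ)) (iteratedDeriv (k + 1) (psi κ μ σ ρ) x) x := by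
  rw [iteratedDeriv_succ]
  exact (analyticOnNhd_iteratedDeriv_psi hκ hσ hρ k x (mem_univ x)).differentiableAt.hasDerivAt

lemma psi_ode (hκ : 0 < κ) (hσ : 0 < σ) (hρ : 0 < ρ) (x : ℝ) :
    σ ^ 2 / 2 * iteratedDeriv 2 (psi κ μ σ ρ) x
      + κ * (μ - x) * iteratedDeriv 1 (psi κ μ σ ρ) x
      - ρ * iteratedDeriv 0 (psi κ μ σ ρ) x = 0 := by
  set s := Real.sqrt (2 * κ) / σ with hs
  have hs2 : σ ^ 2 / 2 * s ^ 2 = κ := by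
    rw [hs, div_pow, Real.sq_sqrt (by positivity)]
    field_simp
  have hset := integrableExpSet_psiMeasure (μ := μ) (σ := σ) hκ hρ
  rw [← hs] at hset
  have hi := integrable_pow_mul_exp_of_integrableExpSet_eq_univ hset x
  have hE : ∀ j, iteratedDeriv j (psi κ μ σ ρ) x =
      ∫ t, (s * t) ^ j * Real.exp (x * (s * t)) ∂(psiMeasure κ μ σ ρ) := fun j => by
    rw [psi_eq_mgf hκ hσ hρ]
    exact iteratedDeriv_mgf (by rw [hset]; simp) j
  have hi2 : Integrable (fun t => σ ^ 2 / 2 * ((s * t) ^ 2 * Real.exp (x * (s * t))) +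
      κ * (μ - x) * ((s * t) ^ 1 * Real.exp (x * (s * t)))) (psiMeasure κ μ σ ρ) :=
    ((hi 2).const_mul _).add ((hi 1).const_mul _)
  rw [hE, hE, hE, ← integral_const_mul, ← integral_const_mul, ← integral_const_mul,
    ← integral_add ((hi 2).const_mul _) ((hi 1).const_mul _),
    ← integral_sub hi2 ((hi 0).const_mul _),
    integral_psiMeasure hκ hρ]
  have h := congrArg (fun y => -(κ * (Real.Gamma (ρ / κ))⁻¹) * y)
    (integral_rpow_mul_exp_neg_sq_half_add_recurrence (div_pos hρ hκ) (s * (x - μ)))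
  simp only [mul_zero] at h
  rw [← integral_const_mul] at h
  refine (setIntegral_congr_fun measurableSet_Ioi ?_).trans h
  intro t ht
  have ht0 : 0 < t := ht
  have h1 : t ^ (ρ / κ) = t ^ (ρ / κ - 1) * t := by
    rw [← Real.rpow_add_one ht0.ne', sub_add_cancel]
  have h2 : Real.exp (-t ^ 2 / 2 + s * (x - μ) * t) =
      Real.exp (-t ^ 2 / 2 + -(s * μ) * t) * Real.exp (x * (s * t)) := by
    rw [← Real.exp_add]
    ring_nf
  simp only
  rw [Real.rpow_add_one ht0.ne', h1, h2, ← hs]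
  have h3 : κ * (ρ / κ) = ρ := by field_simp
  linear_combination (Real.Gamma (ρ / κ))⁻¹ * t ^ (ρ / κ - 1) *
    Real.exp (-t ^ 2 / 2 + -(s * μ) * t) * Real.exp (x * (s * t)) * (t ^ 2 * hs2 + h3)

lemma iteratedDeriv_psi_mul_lt (hκ : 0 < κ) (hσ : 0 < σ) (hρ : 0 < ρ) (x : ℝ) :
    ρ * (iteratedDeriv 0 (psi κ μ σ ρ) x * iteratedDeriv 2 (psi κ μ σ ρ) x) <
      (ρ + κ) * iteratedDeriv 1 (psi κ μ σ ρ) x ^ 2 := by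
  have hd := hasDerivAt_iteratedDeriv_psi (μ := μ) hκ hσ hρ
  have h0 := psi_ode (μ := μ) hκ hσ hρ
  have h1 : σ ^ 2 / 2 * iteratedDeriv 3 (psi κ μ σ ρ) x
      + κ * (μ - x) * iteratedDeriv 2 (psi κ μ σ ρ) x
      - (ρ + κ) * iteratedDeriv 1 (psi κ μ σ ρ) x = 0 := by
    have h := (((hd 2 x).const_mul (σ ^ 2 / 2)).add
      ((((hasDerivAt_id x).const_sub μ).const_mul κ).mul (hd 1 x))).sub ((hd 0 x).const_mul ρ)
    have h2 := h.unique ((hasDerivAt_const x (0 : ℝ)).congr_of_eventuallyEq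
      (Eventually.of_forall fun y => h0 y))
    simp only [id] at h2
    linear_combination h2
  have hQ := Q_pos (μ := μ) hκ hσ hρ 1 x
  rw [Q] at hQ
  simp only [Nat.reduceAdd] at hQ
  have h2 := mul_pos (by positivity : 0 < σ ^ 2 / 2) hQ
  have h3 := h0 x
  set p0 := iteratedDeriv 0 (psi κ μ σ ρ) x
  set p1 := iteratedDeriv 1 (psi κ μ σ ρ) x
  set p2 := iteratedDeriv 2 (psi κ μ σ ρ) x
  set p3 := iteratedDeriv 3 (psi κ μ σ ρ) x
  have h4 : σ ^ 2 / 2 * (p1 * p3 - p2 ^ 2) = (ρ + κ) * p1 ^ 2 - ρ * (p0 * p2) := by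
    linear_combination p1 * h1 - p2 * h3
  linarith

lemma deriv_Q_zero (hκ : 0 < κ) (hσ : 0 < σ) (hρ : 0 < ρ) (x : ℝ) :
    deriv (Q κ μ σ ρ 0) x =
      iteratedDeriv 0 (psi κ μ σ ρ) x * iteratedDeriv 3 (psi κ μ σ ρ) x -
        iteratedDeriv 1 (psi κ μ σ ρ) x * iteratedDeriv 2 (psi κ μ σ ρ) x := by
  have hd := hasDerivAt_iteratedDeriv_psi (μ := μ) hκ hσ hρ
  refine HasDerivAt.deriv ((((hd 0 x).mul (hd 2 x)).sub ((hd 1 x).pow 2)).congr_deriv ?_)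
  norm_num
  ring

lemma Nfun_eq (hρ : 0 < ρ) (β c y z : ℝ) :
    Nfun κ μ σ ρ β c y z = Q κ μ σ ρ 0 z *
      (2 * (ρ + κ) / ρ * iteratedDeriv 1 (psi κ μ σ ρ) z +
        (ρ + κ) * (c - Rt κ μ ρ β z y) * iteratedDeriv 2 (psi κ μ σ ρ) z) := by
  rw [Nfun, iteratedDeriv_one]
  field_simp
  ring

lemma Dfun_eq (hκ : 0 < κ) (hσ : 0 < σ) (hρ : 0 < ρ) (β c y z : ℝ) :
    Dfun κ μ σ ρ β c y z = iteratedDeriv 0 (psi κ μ σ ρ) z *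
      ((ρ + κ) * (c - Rt κ μ ρ β z y) * Q κ μ σ ρ 1 z +
        (iteratedDeriv 0 (psi κ μ σ ρ) z * iteratedDeriv 3 (psi κ μ σ ρ) z -
          iteratedDeriv 1 (psi κ μ σ ρ) z * iteratedDeriv 2 (psi κ μ σ ρ) z)) := by
  rw [Dfun, deriv_Q_zero hκ hσ hρ, iteratedDeriv_zero]

lemma Rt_eq (hκ : 0 < κ) (hρ : 0 < ρ) (β c y z : ℝ) :
    (ρ + κ) * (c - Rt κ μ ρ β z y) =
      (ρ + κ) * c - μ * κ / ρ - z + β * (ρ + 2 * κ) / ρ * y := by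
  rw [Rt]
  field_simp
  ring

/-- Along a line `y = (z - C) / β`, the numerator and denominator of the free-boundary ODE
cannot agree identically: otherwise `ψ / ψ'` would be positive, strictly decreasing and
concave near `+∞`. -/
lemma not_forall_affine (hκ : 0 < κ) (hσ : 0 < σ) (hρ : 0 < ρ) (C : ℝ) :
    ¬ ∀ z, Q κ μ σ ρ 0 z * (2 * (ρ + κ) / ρ * iteratedDeriv 1 (psi κ μ σ ρ) z +
        (2 * κ / ρ * z + C) * iteratedDeriv 2 (psi κ μ σ ρ) z) =
      iteratedDeriv 0 (psi κ μ σ ρ) z * ((2 * κ / ρ * z + C) * Q κ μ σ ρ 1 z +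
        (iteratedDeriv 0 (psi κ μ σ ρ) z * iteratedDeriv 3 (psi κ μ σ ρ) z -
          iteratedDeriv 1 (psi κ μ σ ρ) z * iteratedDeriv 2 (psi κ μ σ ρ) z)) := by
  intro H
  have hd := hasDerivAt_iteratedDeriv_psi (μ := μ) hκ hσ hρ
  have hpos := iteratedDeriv_psi_pos (μ := μ) hκ hσ hρ
  have hQ := Q_pos (μ := μ) hκ hσ hρ
  have hlt := iteratedDeriv_psi_mul_lt (μ := μ) hκ hσ hρ
  have hQ1 : ∀ z, Q κ μ σ ρ 1 z = iteratedDeriv 1 (psi κ μ σ ρ) z *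
      iteratedDeriv 3 (psi κ μ σ ρ) z - iteratedDeriv 2 (psi κ μ σ ρ) z ^ 2 := fun z => rfl
  have hQ0 : ∀ z, Q κ μ σ ρ 0 z = iteratedDeriv 0 (psi κ μ σ ρ) z *
      iteratedDeriv 2 (psi κ μ σ ρ) z - iteratedDeriv 1 (psi κ μ σ ρ) z ^ 2 := fun z => rfl
  set p := fun k => iteratedDeriv k (psi κ μ σ ρ)
  change ∀ k x, HasDerivAt (p k) (p (k + 1) x) x at hd
  change ∀ k x, 0 < p k x at hpos
  change ∀ z, Q κ μ σ ρ 0 z * (2 * (ρ + κ) / ρ * p 1 z + (2 * κ / ρ * z + C) * p 2 z) =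
    p 0 z * ((2 * κ / ρ * z + C) * Q κ μ σ ρ 1 z + (p 0 z * p 3 z - p 1 z * p 2 z)) at H
  change ∀ z, ρ * (p 0 z * p 2 z) < (ρ + κ) * p 1 z ^ 2 at hlt
  change ∀ z, Q κ μ σ ρ 1 z = p 1 z * p 3 z - p 2 z ^ 2 at hQ1
  change ∀ z, Q κ μ σ ρ 0 z = p 0 z * p 2 z - p 1 z ^ 2 at hQ0
  clear_value p
  have hne := fun x => (hpos 1 x).ne'
  set X := -C * ρ / (2 * κ) with hX
  have hg : ∀ z, X ≤ z → 0 ≤ 2 * κ / ρ * z + C := by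
    intro z hz
    have : 2 * κ / ρ * X + C = 0 := by rw [hX]; field_simp; ring
    have : 2 * κ / ρ * X ≤ 2 * κ / ρ * z := by gcongr
    linarith
  have hw : ∀ z, HasDerivAt (fun x => p 0 x / p 1 x) (-(Q κ μ σ ρ 0 z / p 1 z ^ 2)) z := by
    intro z
    refine ((hd 0 z).div (hd 1 z) (hne z)).congr_deriv ?_
    rw [hQ0]
    ring
  have hq : ∀ z, HasDerivAt (fun x => Q κ μ σ ρ 0 x / p 1 x ^ 2)
      ((p 0 z * Q κ μ σ ρ 1 z - p 2 z * Q κ μ σ ρ 0 z) / p 1 z ^ 3) z := by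
    intro z
    have h := (((hd 0 z).mul (hd 2 z)).sub ((hd 1 z).pow 2)).div ((hd 1 z).pow 2)
      (pow_ne_zero 2 (hne z))
    have hfun : (fun x => Q κ μ σ ρ 0 x / p 1 x ^ 2) =
        (p 0 * p 2 - p 1 ^ 2) / p 1 ^ 2 := by
      funext x
      simp [hQ0]
    rw [hfun]
    refine h.congr_deriv ?_
    have := hne z
    rw [hQ0, hQ1]
    simp only [Pi.mul_apply, Pi.sub_apply, Pi.pow_apply]
    norm_num
    field_simp
    ring
  have hq_nonneg : ∀ z, X ≤ z →
      0 ≤ (p 0 z * Q κ μ σ ρ 1 z - p 2 z * Q κ μ σ ρ 0 z) / p 1 z ^ 3 := by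
    intro z hz
    refine div_nonneg ?_ (pow_pos (hpos 1 z) 3).le
    have hG : 0 < p 1 z * (2 * κ / ρ * z + C) + p 0 z := by
      have := mul_nonneg (hpos 1 z).le (hg z hz)
      linarith [hpos 0 z]
    have hS : ρ * ((p 1 z * (2 * κ / ρ * z + C) + p 0 z) *
        (p 0 z * Q κ μ σ ρ 1 z - p 2 z * Q κ μ σ ρ 0 z)) =
        2 * Q κ μ σ ρ 0 z * ((ρ + κ) * p 1 z ^ 2 - ρ * (p 0 z * p 2 z)) := by
      have h1 := H z
      have h2 : 2 * (ρ + κ) / ρ * ρ = 2 * (ρ + κ) := by field_simp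
      rw [hQ0, hQ1] at *
      linear_combination (-ρ * p 1 z) * h1 + (p 0 z * p 2 z - p 1 z ^ 2) * p 1 z ^ 2 * h2
    have h3 : 0 < 2 * Q κ μ σ ρ 0 z * ((ρ + κ) * p 1 z ^ 2 - ρ * (p 0 z * p 2 z)) :=
      mul_pos (by linarith [hQ 0 z]) (by linarith [hlt z])
    rw [← hS] at h3
    exact (pos_of_mul_pos_right (pos_of_mul_pos_right h3 hρ.le) hG.le).le
  have hmono : MonotoneOn (fun x => Q κ μ σ ρ 0 x / p 1 x ^ 2) (Ici X) := by
    refine monotoneOn_of_hasDerivWithinAt_nonneg (convex_Ici X)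
      (fun z _ => (hq z).continuousAt.continuousWithinAt)
      (fun z _ => (hq z).hasDerivWithinAt) (fun z hz => hq_nonneg z ?_)
    exact interior_subset hz
  set m := Q κ μ σ ρ 0 X / p 1 X ^ 2 with hm
  have hm0 : 0 < m := div_pos (hQ 0 X) (pow_pos (hpos 1 X) 2)
  have hanti : AntitoneOn (fun x => p 0 x / p 1 x + m * x) (Ici X) := by
    refine antitoneOn_of_hasDerivWithinAt_nonpos (convex_Ici X)
      (f' := fun z => -(Q κ μ σ ρ 0 z / p 1 z ^ 2) + m * 1)
      (fun z _ => ((hw z).add ((hasDerivAt_id z).const_mul m)).continuousAt.continuousWithinAt)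
      (fun z _ => ((hw z).add ((hasDerivAt_id z).const_mul m)).hasDerivWithinAt)
      (fun z hz => ?_)
    have hz' : X ≤ z := interior_subset hz
    have := hmono self_mem_Ici hz' hz'
    simp only at this
    linarith
  have hwX : 0 < p 0 X / p 1 X := div_pos (hpos 0 X) (hpos 1 X)
  have hle : X ≤ X + p 0 X / p 1 X / m := by linarith [div_pos hwX hm0]
  have h := hanti self_mem_Ici hle hle
  simp only at h
  have h1 := div_pos (hpos 0 (X + p 0 X / p 1 X / m)) (hpos 1 (X + p 0 X / p 1 X / m))
  have h2 : m * (X + p 0 X / p 1 X / m) = m * X + p 0 X / p 1 X := by field_simp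
  linarith

/-- The same non-degeneracy on an arbitrarily short interval, by analyticity. -/
lemma not_forall_affine_Ioo (hκ : 0 < κ) (hσ : 0 < σ) (hρ : 0 < ρ) (C : ℝ) {u v : ℝ}
    (huv : u < v) :
    ¬ ∀ z ∈ Ioo u v, Q κ μ σ ρ 0 z * (2 * (ρ + κ) / ρ * iteratedDeriv 1 (psi κ μ σ ρ) z +
        (2 * κ / ρ * z + C) * iteratedDeriv 2 (psi κ μ σ ρ) z) =
      iteratedDeriv 0 (psi κ μ σ ρ) z * ((2 * κ / ρ * z + C) * Q κ μ σ ρ 1 z +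
        (iteratedDeriv 0 (psi κ μ σ ρ) z * iteratedDeriv 3 (psi κ μ σ ρ) z -
          iteratedDeriv 1 (psi κ μ σ ρ) z * iteratedDeriv 2 (psi κ μ σ ρ) z)) := by
  intro H
  have ha := fun k z => analyticOnNhd_iteratedDeriv_psi (μ := μ) hκ hσ hρ k z (mem_univ z)
  have hQ : ∀ k z, AnalyticAt ℝ (Q κ μ σ ρ k) z := fun k z =>
    ((ha k z).mul (ha (k + 2) z)).sub ((ha (k + 1) z).pow 2)
  have hg : ∀ z, AnalyticAt ℝ (fun z : ℝ => 2 * κ / ρ * z + C) z := fun z => by fun_prop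
  have hl : AnalyticOnNhd ℝ (fun z => Q κ μ σ ρ 0 z *
      (2 * (ρ + κ) / ρ * iteratedDeriv 1 (psi κ μ σ ρ) z +
        (2 * κ / ρ * z + C) * iteratedDeriv 2 (psi κ μ σ ρ) z)) univ := fun z _ =>
    (hQ 0 z).mul ((analyticAt_const.mul (ha 1 z)).add ((hg z).mul (ha 2 z)))
  have hr : AnalyticOnNhd ℝ (fun z => iteratedDeriv 0 (psi κ μ σ ρ) z *
      ((2 * κ / ρ * z + C) * Q κ μ σ ρ 1 z +
        (iteratedDeriv 0 (psi κ μ σ ρ) z * iteratedDeriv 3 (psi κ μ σ ρ) z -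
          iteratedDeriv 1 (psi κ μ σ ρ) z * iteratedDeriv 2 (psi κ μ σ ρ) z))) univ := fun z _ =>
    (ha 0 z).mul (((hg z).mul (hQ 1 z)).add
      (((ha 0 z).mul (ha 3 z)).sub ((ha 1 z).mul (ha 2 z))))
  have h := hl.eqOn_of_preconnected_of_eventuallyEq hr isPreconnected_univ
    (mem_univ ((u + v) / 2)) <| by
      filter_upwards [Ioo_mem_nhds (show u < (u + v) / 2 by linarith)
        (show (u + v) / 2 < v by linarith)] with z hz using H z hz
  exact not_forall_affine hκ hσ hρ C fun z => h (mem_univ z)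

end Psi

/-- A function that vanishes at the right end of an interval and crosses zero only upwards is
nonpositive on the interval. -/
lemma nonpos_of_deriv_pos_of_eq_zero {G G' : ℝ → ℝ} {b : ℝ}
    (hG : ∀ y ∈ Icc 0 b, HasDerivAt G (G' y) y) (hb : G b = 0)
    (hpos : ∀ y ∈ Icc 0 b, G y = 0 → 0 < G' y) : ∀ y ∈ Icc 0 b, G y ≤ 0 := by
  have hmem : ∀ t ∈ Icc 0 b, b - t ∈ Icc 0 b := fun t ht => ⟨by linarith [ht.2], by linarith [ht.1]⟩
  have hd : ∀ t ∈ Icc 0 b, HasDerivAt (fun t => G (b - t)) (-G' (b - t)) t := fun t ht => by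
    simpa [Function.comp_def] using (hG _ (hmem t ht)).comp t ((hasDerivAt_id t).const_sub b)
  have h := image_le_of_deriv_right_lt_deriv_boundary' (f := fun t => G (b - t))
    (f' := fun t => -G' (b - t)) (B := fun _ => 0) (B' := fun _ => 0) (a := 0) (b := b)
    (fun t ht => (hd t ht).continuousAt.continuousWithinAt)
    (fun t ht => (hd t (Ico_subset_Icc_self ht)).hasDerivWithinAt) (by simp [hb])
    continuousOn_const (fun t _ => hasDerivWithinAt_const _ _ _)
    (fun t ht h0 => by linarith [hpos _ (hmem t (Ico_subset_Icc_self ht)) h0])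
  intro y hy
  simpa using h (hmem y hy)

lemma strictMonoOn_Icc_of_deriv_nonneg {f f' : ℝ → ℝ} {a b : ℝ}
    (hf : ∀ y ∈ Icc a b, HasDerivAt f (f' y) y) (hf' : ∀ y ∈ Icc a b, 0 ≤ f' y)
    (hne : ∀ u v, a ≤ u → u < v → v ≤ b → ¬ ∀ y ∈ Ioo u v, f y = f u ∧ f' y = 0) :
    StrictMonoOn f (Icc a b) := by
  have hmono : MonotoneOn f (Icc a b) :=
    monotoneOn_of_hasDerivWithinAt_nonneg (convex_Icc a b)
      (fun y hy => (hf y hy).continuousAt.continuousWithinAt)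
      (fun y hy => (hf y (interior_subset hy)).hasDerivWithinAt)
      (fun y hy => hf' y (interior_subset hy))
  intro u hu v hv huv
  refine (hmono hu hv huv.le).lt_of_ne fun heq => hne u v hu.1 huv hv.2 fun y hy => ?_
  have hconst : ∀ t ∈ Ioo u v, f t = f u := fun t ht => by
    have htm : t ∈ Icc a b := ⟨hu.1.trans ht.1.le, ht.2.le.trans hv.2⟩
    exact le_antisymm ((hmono htm hv ht.2.le).trans heq.ge) (hmono hu htm ht.1.le)
  refine ⟨hconst y hy, ?_⟩
  refine (hf y ⟨hu.1.trans hy.1.le, hy.2.le.trans hv.2⟩).unique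
    ((hasDerivAt_const y (f u)).congr_of_eventuallyEq ?_)
  filter_upwards [Ioo_mem_nhds hy.1 hy.2] with t ht using hconst t ht

lemma crossing_slope_eq {κ ρ β g p0 p1 p2 p3 : ℝ} (hρ : 0 < ρ)
    (h0 : 0 < p0) (h1 : 0 < p1) (h2 : 0 < p2) (hQ : 0 < p0 * p2 - p1 ^ 2)
    (hg : p1 * g + p0 = 0) :
    β * (ρ + 2 * κ) / ρ * p1 + g * p2 * (β * ((p0 * p2 - p1 ^ 2) *
      (2 * (ρ + κ) / ρ * p1 + g * p2)) / (p0 * (g * (p1 * p3 - p2 ^ 2) + (p0 * p3 - p1 * p2)))) =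
      β * (p0 * p2 - p1 ^ 2) / p1 := by
  obtain rfl : g = -p0 / p1 := by
    field_simp
    linarith
  have hD : p0 * (-p0 / p1 * (p1 * p3 - p2 ^ 2) + (p0 * p3 - p1 * p2)) =
      p0 * p2 * (p0 * p2 - p1 ^ 2) / p1 := by
    field_simp
    ring
  rw [hD]
  have := hQ.ne'
  generalize hq : p0 * p2 - p1 ^ 2 = q at *
  field_simp
  linear_combination β * ρ * hq

/-- The free boundary `F(y) = F̃(y) − βy` is strictly increasing on `[0, ybar]` and
satisfies `F(y) ≥ cρ + (κβ/(ρ+κ))y ≥ cρ`. -/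
theorem stmt14 (κ σ ρ μ β c ybar xt : ℝ) (hκ : 0 < κ) (hσ : 0 < σ) (hρ : 0 < ρ)
    (hβ : 0 < β) (hc : 0 ≤ c) (hybar : 0 < ybar)
    (hxt : Hfun κ μ σ ρ β c ybar xt = 0)
    (Ft : ℝ → ℝ) (hterm : Ft ybar = xt)
    (hODE : ∀ y ∈ Set.Icc (0 : ℝ) ybar,
      HasDerivAt Ft (β * Nfun κ μ σ ρ β c y (Ft y) / Dfun κ μ σ ρ β c y (Ft y)) y)
    (hslope : ∀ y ∈ Set.Icc (0 : ℝ) ybar,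
      β ≤ β * Nfun κ μ σ ρ β c y (Ft y) / Dfun κ μ σ ρ β c y (Ft y)) :
    StrictMonoOn (fun y => Ft y - β * y) (Set.Icc (0 : ℝ) ybar) ∧
      ∀ y ∈ Set.Icc (0 : ℝ) ybar,
        c * ρ + κ * β / (ρ + κ) * y ≤ Ft y - β * y ∧
          c * ρ ≤ c * ρ + κ * β / (ρ + κ) * y := by
  have hd := hasDerivAt_iteratedDeriv_psi (μ := μ) hκ hσ hρ
  have hpos := iteratedDeriv_psi_pos (μ := μ) hκ hσ hρ
  constructor
  · refine strictMonoOn_Icc_of_deriv_nonneg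
      (fun y hy => (hODE y hy).sub ((hasDerivAt_id y).const_mul β))
      (fun y hy => by linarith [hslope y hy]) fun u v hu huv hv H => ?_
    refine not_forall_affine_Ioo (μ := μ) hκ hσ hρ
      ((ρ + κ) * c - μ * κ / ρ - (ρ + 2 * κ) / ρ * (Ft u - β * u))
      (u := Ft u - β * u + β * u) (v := Ft u - β * u + β * v) (by gcongr) fun z hz => ?_
    set y := (z - (Ft u - β * u)) / β with hy
    have hz1 : z = Ft u - β * u + β * y := by
      rw [hy]
      field_simp
      ring
    have hyuv : y ∈ Ioo u v := by
      rw [hz1] at hz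
      exact ⟨lt_of_mul_lt_mul_left (by linarith [hz.1]) hβ.le,
        lt_of_mul_lt_mul_left (by linarith [hz.2]) hβ.le⟩
    obtain ⟨h1, h2⟩ := H y hyuv
    have hFz : Ft y = z := by linarith
    rw [hFz] at h2
    have hND : Nfun κ μ σ ρ β c y z = Dfun κ μ σ ρ β c y z := by
      have h3 : β * (Nfun κ μ σ ρ β c y z / Dfun κ μ σ ρ β c y z) = β * 1 := by
        rw [← mul_div_assoc]
        linarith
      exact eq_of_div_eq_one (mul_left_cancel₀ hβ.ne' h3)
    have hg : 2 * κ / ρ * z + ((ρ + κ) * c - μ * κ / ρ - (ρ + 2 * κ) / ρ * (Ft u - β * u)) =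
        (ρ + κ) * (c - Rt κ μ ρ β z y) := by
      rw [Rt_eq hκ hρ, show Ft u - β * u = z - β * y by linarith]
      field_simp
      ring
    rw [hg, ← Nfun_eq hρ, ← Dfun_eq hκ hσ hρ, hND]
  · have hG : ∀ y ∈ Icc 0 ybar, iteratedDeriv 1 (psi κ μ σ ρ) (Ft y) *
        ((ρ + κ) * (c - Rt κ μ ρ β (Ft y) y)) + iteratedDeriv 0 (psi κ μ σ ρ) (Ft y) ≤ 0 := by
      simp only [Rt_eq hκ hρ]
      refine nonpos_of_deriv_pos_of_eq_zero (fun y hy =>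
        (((hd 1 (Ft y)).comp y (hODE y hy)).mul
          (((hODE y hy).const_sub _).add ((hasDerivAt_id y).const_mul _))).add
          ((hd 0 (Ft y)).comp y (hODE y hy))) ?_ fun y hy h0 => ?_
      · rw [← Rt_eq hκ hρ, hterm]
        rw [Hfun] at hxt
        have h := congrArg (fun t => (ρ + κ) * t) hxt
        have h1 : (ρ + κ) * (ρ + κ)⁻¹ = 1 := mul_inv_cancel₀ (by positivity)
        simp only [iteratedDeriv_one, iteratedDeriv_zero]
        simp only [mul_zero] at h
        linear_combination h - psi κ μ σ ρ xt * h1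
      · rw [← Rt_eq hκ hρ] at h0
        have hQ := Q_pos (μ := μ) hκ hσ hρ 0 (Ft y)
        have h := crossing_slope_eq (κ := κ) (β := β) (p3 := iteratedDeriv 3 (psi κ μ σ ρ) (Ft y))
          hρ (hpos 0 (Ft y)) (hpos 1 (Ft y)) (hpos 2 (Ft y)) hQ h0
        have hslope_pos := div_pos (mul_pos hβ hQ) (hpos 1 (Ft y))
        change _ = β * Q κ μ σ ρ 0 (Ft y) / _ at h
        rw [← h] at hslope_pos
        refine hslope_pos.trans_eq ?_
        have hN := Nfun_eq (κ := κ) (μ := μ) (σ := σ) hρ β c y (Ft y)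
        have hD := Dfun_eq (μ := μ) hκ hσ hρ β c y (Ft y)
        simp only [Q, zero_add, Nat.reduceAdd] at hN hD
        rw [← hN, ← hD, Rt_eq hκ hρ]
        simp only [Pi.add_apply, Function.comp_apply, id]
        ring
    intro y hy
    have hode := psi_ode (μ := μ) hκ hσ hρ (Ft y)
    have h := hG y hy
    rw [Rt_eq hκ hρ] at h
    have h1 := hpos 1 (Ft y)
    have h2 := mul_pos (by positivity : 0 < σ ^ 2 / 2) (hpos 2 (Ft y))
    set p0 := iteratedDeriv 0 (psi κ μ σ ρ) (Ft y)
    set p1 := iteratedDeriv 1 (psi κ μ σ ρ) (Ft y)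
    set p2 := iteratedDeriv 2 (psi κ μ σ ρ) (Ft y)
    have hρκ : 0 < ρ + κ := by positivity
    have hy0 : 0 ≤ κ * β / (ρ + κ) * y := mul_nonneg (by positivity) hy.1
    refine ⟨?_, by linarith⟩
    have h3 : p1 * ((ρ + κ) * (c * ρ + κ * β / (ρ + κ) * y - (Ft y - β * y))) +
        σ ^ 2 / 2 * p2 = ρ * (p1 * ((ρ + κ) * c - μ * κ / ρ - Ft y +
          β * (ρ + 2 * κ) / ρ * y) + p0) := by
      field_simp
      linear_combination 2 * hode
    have h4 := mul_nonpos_of_nonneg_of_nonpos hρ.le h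
    by_contra! h5
    have h6 := mul_pos h1 (mul_pos hρκ (sub_pos.2 h5))
    linarith
end
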